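/- Let τ be an exotic coloured tree whose graph obtained by identifying each β-pair to a single vertex is acyclic, with effective size |τ|, exotic tree factorial τ!, and reduction multiset R(τ). Then |τ|!/τ! = Σ_{τ̄ ∈ R(τ)} |τ̄|!/τ̄!, where for an uncoloured rooted tree τ̄, |τ̄| is its number of vertices and τ̄! is the standard tree factorial defined recursively by •! = 1 and (B₊(τ₁,…,τ_n))! = |B₊(τ₁,…,τ_n)|·τ₁!⋯τ_n!. -/

import Mathlib

/-- The two colours for non-root vertices of an exotic coloured tree. -/
inductive XColour : Type
  | alpha : XColour
  | beta : XColour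
  deriving DecidableEq

/-- An exotic coloured tree: a finite non-planar rooted tree with vertex set
`Fin (n+1)`, distinguished (uncoloured) root `0`, edges oriented towards the root
(encoded by the parent map), whose non-root vertices are coloured by `{α, β}`,
together with a fixed perfect pairing `mate` of the β-vertices (the exotic
decoration); in particular the number of β-vertices is even. -/
structure ExoticTree : Type where
  n : ℕ
  parent : Fin (n + 1) → Fin (n + 1)
  colour : Fin (n + 1) → Option XColour
  mate : Fin (n + 1) → Fin (n + 1)
  parent_root : parent 0 = 0
  reaches_root : ∀ v, parent^[n] v = 0
  colour_root : colour 0 = none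
  colour_nonroot : ∀ v, v ≠ 0 → colour v ≠ none
  mate_beta : ∀ v, colour v = some XColour.beta →
      colour (mate v) = some XColour.beta ∧ mate (mate v) = v ∧ mate v ≠ v
  mate_nonbeta : ∀ v, colour v ≠ some XColour.beta → mate v = v

namespace ExoticTree

/-- The number of children (incoming edges) `𝔫(v)` of a vertex. -/
def nChildren (t : ExoticTree) (v : Fin (t.n + 1)) : ℕ :=
  (Finset.univ.filter fun w => t.parent w = v ∧ w ≠ v).card

/-- A vertex is a leaf if it has no children. -/
def IsLeaf (t : ExoticTree) (v : Fin (t.n + 1)) : Prop := ∀ w, t.parent w = v → w = v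

/-- The number of α-vertices. -/
def numAlpha (t : ExoticTree) : ℕ :=
  (Finset.univ.filter fun v : Fin (t.n + 1) => t.colour v = some XColour.alpha).card

/-- The number of β-vertices. -/
def numBeta (t : ExoticTree) : ℕ :=
  (Finset.univ.filter fun v : Fin (t.n + 1) => t.colour v = some XColour.beta).card

/-- The number of β-pairs (each pair represented by its smaller member). -/
def numPairs (t : ExoticTree) : ℕ :=
  (Finset.univ.filter fun v : Fin (t.n + 1) =>
    t.colour v = some XColour.beta ∧ v < t.mate v).card

/-- The effective size `|τ|`: `1` (the root) plus the number of α-vertices plus the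
number of β-pairs. -/
def effSize (t : ExoticTree) : ℕ := 1 + t.numAlpha + t.numPairs

/-- The edge grading `𝔩(τ) = |τ| − 1`. -/
def edgeCount (t : ExoticTree) : ℕ := t.effSize - 1

/-- Isomorphism of exotic coloured trees: a root-preserving bijection of the vertices
commuting with the parent maps and preserving colours and the β-pairings. -/
def Iso (t₁ t₂ : ExoticTree) : Prop :=
  ∃ e : Fin (t₁.n + 1) ≃ Fin (t₂.n + 1), e 0 = 0 ∧
    (∀ v, t₂.parent (e v) = e (t₁.parent v)) ∧
    (∀ v, t₂.colour (e v) = t₁.colour v) ∧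
    (∀ v, t₂.mate (e v) = e (t₁.mate v))

/-- The symmetry factor `σₑ(τ)`: the order of the group of automorphisms (root-preserving
tree automorphisms preserving colours and mapping paired β-vertices to paired
β-vertices). -/
noncomputable def sigmaE (t : ExoticTree) : ℕ :=
  Nat.card {g : Equiv.Perm (Fin (t.n + 1)) //
    g 0 = 0 ∧ (∀ v, t.parent (g v) = g (t.parent v)) ∧
    (∀ v, t.colour (g v) = t.colour v) ∧ (∀ v, t.mate (g v) = g (t.mate v))}

/-- A tree is monotonically labelled (by creation order) if every non-root vertex is
larger than its parent. -/
def IsMonotoneLabelled (t : ExoticTree) : Prop :=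
  ∀ v : Fin (t.n + 1), v ≠ 0 → t.parent v < v

/-- The two members of each β-pair carry consecutive labels (they are created by
consecutive grafting steps). -/
def PairsConsecutive (t : ExoticTree) : Prop :=
  ∀ v, t.colour v = some XColour.beta →
    ((t.mate v : ℕ) = (v : ℕ) + 1 ∨ (v : ℕ) = (t.mate v : ℕ) + 1)

/-- The number of natural-growth sequences producing `t`.  A natural-growth sequence
(starting from the single-root tree, grafting single α-leaves and simultaneous pairs
of paired β-leaves) is recorded by the tree labelled by creation order — an α-leaf is
created in one step and the two paired β-leaves of one simultaneous grafting occupy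
two consecutive labels — together with, for each β-pair, the datum of which of its
two leaves was attached to which of the two (ordered) chosen attachment vertices. -/
noncomputable def numGrowthSeq (t : ExoticTree) : ℕ :=
  2 ^ t.numPairs *
    Nat.card {s : ExoticTree // s.IsMonotoneLabelled ∧ s.PairsConsecutive ∧ Iso s t}

/-- The exotic Connes–Moscovici weight `CM^e(τ)`: the number of natural-growth
sequences producing `τ`, multiplied by `2^{−(number of β-vertices of τ)}`. -/
noncomputable def CMe (t : ExoticTree) : ℚ :=
  (t.numGrowthSeq : ℚ) / 2 ^ t.numBeta

/-- The α-leaves of `t`. -/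
def alphaLeaves (t : ExoticTree) : Finset (Fin (t.n + 1)) :=
  Finset.univ.filter fun v =>
    t.colour v = some XColour.alpha ∧ ∀ w, t.parent w = v → w = v

/-- The β-pairs both of whose members are leaves (each pair represented by its
smaller member). -/
def betaLeafPairs (t : ExoticTree) : Finset (Fin (t.n + 1)) :=
  Finset.univ.filter fun v =>
    t.colour v = some XColour.beta ∧ v < t.mate v ∧
    (∀ w, t.parent w = v → w = v) ∧ (∀ w, t.parent w = t.mate v → w = t.mate v)

/-- `t'` is (a copy of) the exotic coloured tree obtained from `t` by removing the
α-leaf `ℓ` together with its edge. -/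
def IsAlphaLeafRemoval (t : ExoticTree) (ℓ : Fin (t.n + 1)) (t' : ExoticTree) : Prop :=
  t.colour ℓ = some XColour.alpha ∧ t.IsLeaf ℓ ∧
  ∃ e : Fin (t'.n + 1) ↪ Fin (t.n + 1), e 0 = 0 ∧ Set.range e = {u | u ≠ ℓ} ∧
    (∀ w, t.colour (e w) = t'.colour w) ∧
    (∀ w, t.parent (e w) = e (t'.parent w)) ∧
    (∀ w, t.mate (e w) = e (t'.mate w))

/-- `t'` is (a copy of) the exotic coloured tree obtained from `t` by removing the
paired couple of β-leaves `v`, `mate v` together with their edges. -/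
def IsBetaPairLeafRemoval (t : ExoticTree) (v : Fin (t.n + 1)) (t' : ExoticTree) : Prop :=
  t.colour v = some XColour.beta ∧ t.IsLeaf v ∧ t.IsLeaf (t.mate v) ∧
  ∃ e : Fin (t'.n + 1) ↪ Fin (t.n + 1), e 0 = 0 ∧
    Set.range e = {u | u ≠ v ∧ u ≠ t.mate v} ∧
    (∀ w, t.colour (e w) = t'.colour w) ∧
    (∀ w, t.parent (e w) = e (t'.parent w)) ∧
    (∀ w, t.mate (e w) = e (t'.mate w))

/-- The defining property of the exotic tree factorial `τ!`:
`•! = 1` for the single-root tree, and the recursion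
`|τ|/τ! = Σ_{τ' ∈ T_e⁻(τ)} 1/τ'!`, where `T_e⁻(τ)` consists of the exotic coloured
trees obtained from `τ` by removing one α-leaf or one paired couple of β-leaves
(together with their edges). -/
def IsTreeFactorial (fac : ExoticTree → ℚ) : Prop :=
  (∀ t : ExoticTree, t.n = 0 → fac t = 1) ∧
  ∀ t : ExoticTree, 0 < t.n →
    ∀ (rα : (ℓ : Fin (t.n + 1)) → ℓ ∈ t.alphaLeaves → ExoticTree)
      (rβ : (v : Fin (t.n + 1)) → v ∈ t.betaLeafPairs → ExoticTree),
      (∀ ℓ h, t.IsAlphaLeafRemoval ℓ (rα ℓ h)) →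
      (∀ v h, t.IsBetaPairLeafRemoval v (rβ v h)) →
      (t.effSize : ℚ) / fac t =
        (∑ ℓ ∈ t.alphaLeaves.attach, 1 / fac (rα ℓ.1 ℓ.2)) +
        ∑ v ∈ t.betaLeafPairs.attach, 1 / fac (rβ v.1 v.2)

end ExoticTree

open ExoticTree

/-- A plain (uncoloured) finite non-planar rooted tree: vertex set `Fin (n+1)`,
root `0`, edges oriented towards the root, encoded by the parent map. -/
structure PTree : Type where
  n : ℕ
  parent : Fin (n + 1) → Fin (n + 1)
  parent_root : parent 0 = 0
  reaches_root : ∀ v, parent^[n] v = 0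

namespace ExoticTree

/-- A step of the directed graph obtained from `t` by identifying each β-pair to a
single vertex: there is an edge from the class of `x` to the class of `y` if some
member of the class of `x` is a non-root vertex whose parent is in the class of `y`. -/
def IdStep (t : ExoticTree) (x y : Fin (t.n + 1)) : Prop :=
  ∃ u, (u = x ∨ u = t.mate x) ∧ u ≠ 0 ∧ (t.parent u = y ∨ t.parent u = t.mate y)

/-- The graph obtained from `t` by identifying each β-pair to a single vertex is
acyclic (no directed cycles). -/
def IdAcyclic (t : ExoticTree) : Prop := ∀ x, ¬ Relation.TransGen (t.IdStep) x x

/-- The depth of a vertex: the number of edges on the path to the root. -/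
noncomputable def depth (t : ExoticTree) (v : Fin (t.n + 1)) : ℕ :=
  letI : DecidablePred fun k => t.parent^[k] v = 0 := fun _ => inferInstance
  Nat.find (⟨t.n, t.reaches_root v⟩ : ∃ k, t.parent^[k] v = 0)

/-- `parent^[d₁] b = parent^[d₂] (mate b)` is the first common vertex of the two
downward closing paths issued from the β-pair `b`, `mate b`. -/
def FirstCommon (t : ExoticTree) (b : Fin (t.n + 1)) (d₁ d₂ : ℕ) : Prop :=
  0 < d₁ ∧ 0 < d₂ ∧ t.parent^[d₁] b = t.parent^[d₂] (t.mate b) ∧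
    ∀ i < d₁, ∀ j < d₂, t.parent^[i] b ≠ t.parent^[j] (t.mate b)

/-- The closed branch of the β-pair `b`, `mate b` is (one of those) nearest to the
root: its base has minimal depth among the bases of all closed branches. -/
def NearestPair (t : ExoticTree) (b : Fin (t.n + 1)) (d₁ d₂ : ℕ) : Prop :=
  FirstCommon t b d₁ d₂ ∧
    ∀ b' d₁' d₂', t.colour b' = some XColour.beta → FirstCommon t b' d₁' d₂' →
      t.depth (t.parent^[d₁] b) ≤ t.depth (t.parent^[d₁'] b')

/-- `v` is an internal vertex of one of the two closing paths of the closed branch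
of the β-pair `b`, `mate b`. -/
def OnClosingPath (t : ExoticTree) (b : Fin (t.n + 1)) (d₁ d₂ : ℕ)
    (v : Fin (t.n + 1)) : Prop :=
  (∃ i, 0 < i ∧ i < d₁ ∧ v = t.parent^[i] b) ∨
    ∃ j, 0 < j ∧ j < d₂ ∧ v = t.parent^[j] (t.mate b)

end ExoticTree

/-- A shuffle of two chains of lengths `a` and `b`: an interleaving of their elements
into a single chain of length `a + b` preserving the relative order within each
chain. -/
def ShuffleT (a b : ℕ) : Type :=
  {p : (Fin a → Fin (a + b)) × (Fin b → Fin (a + b)) //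
    (∀ i j, i < j → p.1 i < p.1 j) ∧ (∀ i j, i < j → p.2 i < p.2 j) ∧
      ∀ x, (∃ i, p.1 i = x) ∨ ∃ j, p.2 j = x}

instance (a b : ℕ) : Fintype (ShuffleT a b) := by
  unfold ShuffleT; infer_instance

namespace ExoticTree

/-- `t'` is (a copy of) the exotic coloured tree obtained from `t` by merging the two
closing paths of the closed branch of the β-pair `b`, `mate b` into a single path,
interleaving their internal vertices according to the shuffle `sh` (the pair itself
is identified to a single vertex, placed at the top of the merged path, and all other
vertices, colours, β-pairings and subtrees are carried along unchanged). -/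
def IsMergeAt (t : ExoticTree) (b : Fin (t.n + 1)) (d₁ d₂ : ℕ)
    (sh : ShuffleT (d₁ - 1) (d₂ - 1)) (t' : ExoticTree) : Prop :=
  t.n = t'.n + 1 ∧
  ∃ φ : Fin (t.n + 1) → Fin (t'.n + 1),
    Function.Surjective φ ∧ φ 0 = 0 ∧ φ b = φ (t.mate b) ∧
    (∀ u v, φ u = φ v → u = v ∨ ((u = b ∨ u = t.mate b) ∧ (v = b ∨ v = t.mate b))) ∧
    (∀ v, v ≠ b → v ≠ t.mate b → t'.colour (φ v) = t.colour v) ∧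
    t'.colour (φ b) = some XColour.alpha ∧
    (∀ v, v ≠ b → v ≠ t.mate b → t'.mate (φ v) = φ (t.mate v)) ∧
    t'.mate (φ b) = φ b ∧
    (∀ v, v ≠ b → v ≠ t.mate b → ¬ t.OnClosingPath b d₁ d₂ v →
      t'.parent (φ v) = φ (t.parent v)) ∧
    ∃ ch : Fin (d₁ - 1 + (d₂ - 1) + 1) → Fin (t'.n + 1),
      ch (Fin.last _) = φ b ∧
      t'.parent (ch 0) = φ (t.parent^[d₁] b) ∧
      (∀ i : Fin (d₁ - 1 + (d₂ - 1)), t'.parent (ch i.succ) = ch i.castSucc) ∧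
      (∀ i : Fin (d₁ - 1), ch ((sh.1.1 i).castSucc) = φ (t.parent^[d₁ - 1 - (i : ℕ)] b)) ∧
      ∀ j : Fin (d₂ - 1), ch ((sh.1.2 j).castSucc) = φ (t.parent^[d₂ - 1 - (j : ℕ)] (t.mate b))

end ExoticTree

open ExoticTree

/-- `IsReduction t M`: `M` is the reduction multiset `R(t)` of the exotic coloured
tree `t`.  If `t` has no β-vertices, `R(t)` is the singleton of the underlying
uncoloured rooted tree; otherwise one successively merges the two closing paths of
the closed branch nearest to the root, in every interleaving (shuffle) preserving the
relative order of the vertices within each closing path, and takes the multiset sum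
over all shuffles (one reduced tree per choice of shuffles). -/
inductive IsReduction : ExoticTree → Multiset PTree → Prop where
  | base (t : ExoticTree) (s : PTree) (h0 : t.numBeta = 0)
      (hiso : ∃ e : Fin (t.n + 1) ≃ Fin (s.n + 1), e 0 = 0 ∧
        ∀ v, s.parent (e v) = e (t.parent v)) :
      IsReduction t {s}
  | merge (t : ExoticTree) (b : Fin (t.n + 1)) (d₁ d₂ : ℕ)
      (hβ : t.colour b = some XColour.beta)
      (hnear : t.NearestPair b d₁ d₂)
      (next : ShuffleT (d₁ - 1) (d₂ - 1) → ExoticTree)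
      (Ms : ShuffleT (d₁ - 1) (d₂ - 1) → Multiset PTree)
      (hmerge : ∀ sh, t.IsMergeAt b d₁ d₂ sh (next sh))
      (hnext : ∀ sh, IsReduction (next sh) (Ms sh)) :
      IsReduction t (∑ sh : ShuffleT (d₁ - 1) (d₂ - 1), Ms sh)

namespace PTree

/-- The root children of an uncoloured rooted tree. -/
def rootChildren (s : PTree) : Finset (Fin (s.n + 1)) :=
  Finset.univ.filter fun v => s.parent v = 0 ∧ v ≠ 0

/-- `s'` is (a copy of) the subtree of `s` rooted at the vertex `c`, so that
`s = B₊(s'₁, …, s'ₖ)` for the subtrees at the root children. -/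
def IsSubtreeAt (s : PTree) (c : Fin (s.n + 1)) (s' : PTree) : Prop :=
  ∃ e : Fin (s'.n + 1) ↪ Fin (s.n + 1), e 0 = c ∧
    Set.range e = {u | ∃ k, s.parent^[k] u = c} ∧
    ∀ w, w ≠ 0 → s.parent (e w) = e (s'.parent w)

end PTree

/-- The defining property of the standard tree factorial for uncoloured rooted trees:
`•! = 1` and `(B₊(τ₁,…,τₖ))! = |B₊(τ₁,…,τₖ)|·τ₁!⋯τₖ!` (every tree with at least one
non-root vertex is `B₊` of the subtrees at its root children). -/
def IsPlainFactorial (pfac : PTree → ℕ) : Prop :=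
  (∀ s : PTree, s.n = 0 → pfac s = 1) ∧
  ∀ s : PTree, 0 < s.n →
    ∀ st : (c : Fin (s.n + 1)) → c ∈ s.rootChildren → PTree,
      (∀ c h, s.IsSubtreeAt c (st c h)) →
      pfac s = (s.n + 1) * ∏ c ∈ s.rootChildren.attach, pfac (st c.1 c.2)

/-- `p` is the parent map of a rooted tree with root `r`. -/
structure IsRooted {V : Type*} (r : V) (p : V → V) : Prop where
  root : p r = r
  reach : ∀ v, ∃ k, p^[k] v = r

namespace IsRooted

variable {V : Type*} {r : V} {p : V → V}

theorem iterate_root (h : IsRooted r p) (k : ℕ) : p^[k] r = r :=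
  Function.iterate_fixed h.root k

theorem eq_root_of_periodic (h : IsRooted r p) {v : V} {k : ℕ} (hk : 0 < k)
    (hv : p^[k] v = v) : v = r := by
  obtain ⟨N, hN⟩ := h.reach v
  have hper : Function.IsPeriodicPt p (k * N) v :=
    (show Function.IsPeriodicPt p k v from hv).mul_const N
  have hle : N ≤ k * N := Nat.le_mul_of_pos_left N hk
  rw [← hper.eq, ← Nat.sub_add_cancel hle, Function.iterate_add_apply, hN, h.iterate_root]

theorem iterate_card (h : IsRooted r p) [Fintype V] {n : ℕ} (hn : Fintype.card V = n + 1)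
    (v : V) : p^[n] v = r := by
  classical
  have hex := h.reach v
  have hinj : Function.Injective fun i : Fin (Nat.find hex + 1) => p^[(i : ℕ)] v := by
    have key : ∀ i j : ℕ, i < j → j ≤ Nat.find hex → p^[i] v ≠ p^[j] v := by
      intro i j hij hj he
      refine Nat.find_min hex (m := Nat.find hex - j + i) (by omega) ?_
      rw [Function.iterate_add_apply, he, ← Function.iterate_add_apply,
        Nat.sub_add_cancel hj, Nat.find_spec hex]
    intro i j hij
    rcases lt_trichotomy (i : ℕ) j with hlt | heq | hlt
    · exact absurd hij (key _ _ hlt (by omega))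
    · exact Fin.ext heq
    · exact absurd hij.symm (key _ _ hlt (by omega))
  have hcard := Fintype.card_le_of_injective _ hinj
  rw [Fintype.card_fin, hn] at hcard
  rw [← Nat.sub_add_cancel (show Nat.find hex ≤ n by omega), Function.iterate_add_apply,
    Nat.find_spec hex, h.iterate_root]

end IsRooted

open Classical in
/-- The vertices of the subtree above `v`, for the parent map `p`. -/
noncomputable def descendants {V : Type*} [Fintype V] (p : V → V) (v : V) : Finset V :=
  Finset.univ.filter fun w => ∃ k, p^[k] w = v

open Classical in
/-- The children of `v`, for the parent map `p`. -/
noncomputable def childrenOf {V : Type*} [Fintype V] (p : V → V) (v : V) : Finset V :=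
  Finset.univ.filter fun w => p w = v ∧ w ≠ v

section Descendants

variable {V : Type*} [Fintype V] {r : V} {p : V → V}

@[simp] theorem mem_descendants {v w : V} : w ∈ descendants p v ↔ ∃ k, p^[k] w = v := by
  simp [descendants]

@[simp] theorem mem_childrenOf {v w : V} : w ∈ childrenOf p v ↔ p w = v ∧ w ≠ v := by
  simp [childrenOf]

theorem self_mem_descendants (v : V) : v ∈ descendants p v := mem_descendants.2 ⟨0, rfl⟩

theorem descendants_root (h : IsRooted r p) : descendants p r = Finset.univ := by
  ext w; simpa using h.reach w

theorem descendants_trans {u v w : V} (hv : v ∈ descendants p u) (hw : w ∈ descendants p v) :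
    w ∈ descendants p u := by
  obtain ⟨k, rfl⟩ := mem_descendants.1 hw
  obtain ⟨j, rfl⟩ := mem_descendants.1 hv
  exact mem_descendants.2 ⟨j + k, Function.iterate_add_apply _ _ _ _⟩

theorem descendants_antisymm (h : IsRooted r p) {u v : V} (hv : v ∈ descendants p u)
    (hu : u ∈ descendants p v) : u = v := by
  obtain ⟨k, hk⟩ := mem_descendants.1 hu
  obtain ⟨j, hj⟩ := mem_descendants.1 hv
  rcases Nat.eq_zero_or_pos k with rfl | hpos
  · exact hk
  have hr : u = r := h.eq_root_of_periodic (k := j + k) (by omega)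
    (by rw [Function.iterate_add_apply, hk, hj])
  rw [← hk, hr, h.iterate_root]

theorem notMem_descendants_child (h : IsRooted r p) {c v : V} (hc : c ∈ childrenOf p v) :
    v ∉ descendants p c := by
  intro hv
  obtain ⟨hc1, hc2⟩ := mem_childrenOf.1 hc
  exact hc2 (descendants_antisymm h hv (mem_descendants.2 ⟨1, hc1⟩))

theorem descendants_child_disjoint (h : IsRooted r p) (v : V) :
    (childrenOf p v : Set V).PairwiseDisjoint (descendants p) := by
  have key : ∀ c ∈ childrenOf p v, ∀ c' ∈ childrenOf p v, ∀ w k j, k < j →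
      p^[k] w = c → p^[j] w = c' → False := by
    intro c hc c' hc' w k j hkj hk hj
    refine notMem_descendants_child h hc' (mem_descendants.2 ⟨j - k - 1, ?_⟩)
    rw [← (mem_childrenOf.1 hc).1, ← hk, ← Function.iterate_succ_apply' p,
      ← Function.iterate_add_apply, ← hj]
    congr 1
    omega
  intro c hc c' hc' hne
  rw [Function.onFun, Finset.disjoint_left]
  intro w hw hw'
  obtain ⟨k, hk⟩ := mem_descendants.1 hw
  obtain ⟨j, hj⟩ := mem_descendants.1 hw'
  rcases lt_trichotomy k j with hlt | rfl | hlt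
  · exact key c hc c' hc' w k j hlt hk hj
  · exact hne (hk.symm.trans hj)
  · exact key c' hc' c hc w j k hlt hj hk

open Classical in
theorem descendants_eq_insert (p : V → V) (v : V) :
    descendants p v = insert v ((childrenOf p v).biUnion (descendants p)) := by
  ext w
  simp only [mem_descendants, Finset.mem_insert, Finset.mem_biUnion, mem_childrenOf]
  constructor
  · rintro ⟨k, hk⟩
    induction k generalizing w with
    | zero => exact Or.inl hk
    | succ k ih =>
      rcases ih (p w) hk with heq | ⟨c, hc, j, hj⟩
      · by_cases hw : w = v
        · exact Or.inl hw
        · exact Or.inr ⟨w, ⟨heq, hw⟩, 0, rfl⟩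
      · exact Or.inr ⟨c, hc, j + 1, hj⟩
  · rintro (rfl | ⟨c, ⟨hc, -⟩, j, hj⟩)
    · exact ⟨0, rfl⟩
    · exact ⟨j + 1, by rw [Function.iterate_succ_apply', hj, hc]⟩

@[to_additive]
theorem prod_descendants {M : Type*} [CommMonoid M] (h : IsRooted r p) (v : V) (f : V → M) :
    ∏ w ∈ descendants p v, f w = f v * ∏ c ∈ childrenOf p v, ∏ w ∈ descendants p c, f w := by
  classical
  rw [descendants_eq_insert p v, Finset.prod_insert, Finset.prod_biUnion
    (descendants_child_disjoint h v)]
  simp only [Finset.mem_biUnion, not_exists, not_and]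
  exact fun c hc => notMem_descendants_child h hc

theorem card_descendants (h : IsRooted r p) (v : V) :
    (descendants p v).card = 1 + ∑ c ∈ childrenOf p v, (descendants p c).card := by
  simpa only [Finset.card_eq_sum_ones] using sum_descendants h v (fun _ => 1)

theorem card_descendants_pos (v : V) : 0 < (descendants p v).card :=
  Finset.card_pos.2 ⟨v, self_mem_descendants v⟩

theorem card_descendants_child_lt (h : IsRooted r p) {c v : V} (hc : c ∈ childrenOf p v) :
    (descendants p c).card < (descendants p v).card := by
  rw [card_descendants h v]
  have := Finset.single_le_sum (f := fun c => (descendants p c).card) (fun _ _ => Nat.zero_le _) hc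
  omega

theorem card_descendants_eq_one_iff (h : IsRooted r p) (v : V) :
    (descendants p v).card = 1 ↔ childrenOf p v = ∅ := by
  rw [card_descendants h v]
  constructor
  · intro hs
    refine Finset.eq_empty_of_forall_notMem fun c hc => ?_
    have := card_descendants_child_lt h hc
    have := card_descendants_pos (p := p) c
    have := card_descendants h v
    omega
  · intro he
    simp [he]

open Classical in
theorem sum_leaves_descendants (h : IsRooted r p) (v : V) :
    ∑ l ∈ descendants p v, (if childrenOf p l = ∅ then
      ∏ u ∈ descendants p v, (if l ∈ descendants p u ∧ u ≠ l then
        ((descendants p u).card : ℚ) / ((descendants p u).card - 1) else 1) else 0) =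
      (descendants p v).card := by
  induction hn : (descendants p v).card using Nat.strong_induction_on generalizing v with
  | _ n ih =>
  subst hn
  rw [sum_descendants h]
  by_cases hv : childrenOf p v = ∅
  · have hd : descendants p v = {v} := by
      obtain ⟨a, ha⟩ := Finset.card_eq_one.1 ((card_descendants_eq_one_iff h v).2 hv)
      have := self_mem_descendants (p := p) v
      rw [ha, Finset.mem_singleton] at this
      rw [ha, this]
    simp [hv, hd]
  · rw [if_neg hv, zero_add]
    have hne : ((descendants p v).card : ℚ) - 1 ≠ 0 := by
      intro h0
      refine hv ((card_descendants_eq_one_iff h v).1 ?_)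
      exact_mod_cast sub_eq_zero.1 h0
    have hc : ∀ c ∈ childrenOf p v, ∑ l ∈ descendants p c, (if childrenOf p l = ∅ then
        ∏ u ∈ descendants p v, (if l ∈ descendants p u ∧ u ≠ l then
          ((descendants p u).card : ℚ) / ((descendants p u).card - 1) else 1) else 0) =
        ((descendants p v).card : ℚ) / ((descendants p v).card - 1) * (descendants p c).card := by
      intro c hc
      rw [← ih _ (card_descendants_child_lt h hc) c rfl, Finset.mul_sum]
      refine Finset.sum_congr rfl fun l hl => ?_
      rw [mul_ite, mul_zero]
      refine if_congr Iff.rfl ?_ rfl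
      have hlv : l ∈ descendants p v :=
        descendants_trans (mem_descendants.2 ⟨1, (mem_childrenOf.1 hc).1⟩) hl
      have hvl : v ≠ l := fun e => notMem_descendants_child h hc (e ▸ hl)
      rw [prod_descendants h v, if_pos ⟨hlv, hvl⟩]
      congr 1
      refine Finset.prod_eq_single_of_mem c hc fun c' hc' hne' => ?_
      refine Finset.prod_eq_one fun u hu => if_neg ?_
      rintro ⟨hlu, -⟩
      exact Finset.disjoint_left.1 (descendants_child_disjoint h v hc' hc hne')
        (descendants_trans hu hlu) hl
    rw [Finset.sum_congr rfl hc, ← Finset.mul_sum, ← Nat.cast_sum]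
    have hs : (((∑ c ∈ childrenOf p v, (descendants p c).card : ℕ)) : ℚ) =
        (descendants p v).card - 1 := by
      rw [card_descendants h v]; push_cast; ring
    rw [hs]
    field_simp

end Descendants

theorem ncard_eq_sum_of_existsUnique {α ι : Type*} {s : Set α} (hs : s.Finite) (I : Finset ι)
    (P : ι → α → Prop) (h : ∀ a ∈ s, ∃! i, i ∈ I ∧ P i a) :
    s.ncard = ∑ i ∈ I, {a ∈ s | P i a}.ncard := by
  have hU : s = ⋃ i ∈ (I : Set ι), {a ∈ s | P i a} := by
    ext a
    simp only [Set.mem_iUnion, Set.mem_ofPred_eq, Finset.mem_coe, exists_prop]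
    constructor
    · intro ha
      obtain ⟨i, ⟨hi, hP⟩, -⟩ := h a ha
      exact ⟨i, hi, ha, hP⟩
    · rintro ⟨i, -, ha, -⟩
      exact ha
  conv_lhs => rw [hU]
  rw [I.finite_toSet.ncard_biUnion (fun i _ => hs.subset (Set.sep_subset _ _)),
    finsum_mem_coe_finset]
  intro i hi j hj hij
  rw [Function.onFun, Set.disjoint_left]
  rintro a ⟨ha, hPi⟩ ⟨-, hPj⟩
  exact hij ((h a ha).unique ⟨hi, hPi⟩ ⟨hj, hPj⟩)

/-- The increasing labellings, by an initial segment of `ℕ`, of the rooted tree with root `r`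
and parent map `p`, in which exactly the vertices paired by the involution `m` share a label. -/
def labellings {V : Type*} (r : V) (p m : V → V) : Set (V → ℕ) :=
  {f | (∀ u v, f u = f v ↔ u = v ∨ u = m v) ∧ (∀ v, v ≠ r → f (p v) < f v) ∧
    ∀ v k, k < f v → ∃ u, f u = k}

section Labellings

variable {V : Type*} {r : V} {p m : V → V}

theorem apply_mate_of_mem_labellings {f : V → ℕ} (hf : f ∈ labellings r p m) (v : V) :
    f (m v) = f v := (hf.1 _ _).2 (Or.inr rfl)

theorem apply_parent_le_of_mem_labellings (h : IsRooted r p) {f : V → ℕ}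
    (hf : f ∈ labellings r p m) (v : V) : f (p v) ≤ f v := by
  by_cases hv : v = r
  · rw [hv, h.root]
  · exact (hf.2.1 v hv).le

theorem apply_iterate_le_of_mem_labellings (h : IsRooted r p) {f : V → ℕ}
    (hf : f ∈ labellings r p m) (k : ℕ) (v : V) : f (p^[k] v) ≤ f v := by
  induction k with
  | zero => exact le_rfl
  | succ k ih =>
    rw [Function.iterate_succ_apply']
    exact (apply_parent_le_of_mem_labellings h hf _).trans ih

theorem apply_iterate_lt_of_mem_labellings (h : IsRooted r p) {f : V → ℕ}
    (hf : f ∈ labellings r p m) {k : ℕ} (hk : 0 < k) {v : V} (hv : v ≠ r) :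
    f (p^[k] v) < f v := by
  obtain ⟨k, rfl⟩ := Nat.exists_eq_succ_of_ne_zero hk.ne'
  rw [Function.iterate_succ_apply]
  exact (apply_iterate_le_of_mem_labellings h hf k _).trans_lt (hf.2.1 v hv)

theorem finite_labellings [Fintype V] : (labellings r p m).Finite := by
  classical
  refine (Set.Finite.pi' (fun _ : V => Set.finite_Iio (Fintype.card V))).subset ?_
  intro f hf v
  have hsub : Finset.range (f v + 1) ⊆ Finset.univ.image f := by
    intro k hk
    rcases Nat.lt_succ_iff_lt_or_eq.1 (Finset.mem_range.1 hk) with hlt | rfl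
    · obtain ⟨u, hu⟩ := hf.2.2 v k hlt
      exact Finset.mem_image.2 ⟨u, Finset.mem_univ _, hu⟩
    · exact Finset.mem_image_of_mem _ (Finset.mem_univ _)
  have hcard := (Finset.card_le_card hsub).trans Finset.card_image_le
  rw [Finset.card_range, Finset.card_univ] at hcard
  exact hcard

theorem labellings_subsingleton_eq [Subsingleton V] (hr : ∀ v : V, v = r) :
    labellings r p m = {fun _ => 0} := by
  ext f
  rw [Set.mem_singleton_iff]
  constructor
  · intro hf
    funext v
    by_contra hne
    obtain ⟨u, hu⟩ := hf.2.2 v 0 (Nat.pos_of_ne_zero hne)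
    rw [Subsingleton.elim u v] at hu
    exact hne hu
  · rintro rfl
    exact ⟨fun u v => by simp [Subsingleton.elim u v], fun v hv => absurd (hr v) hv,
      fun v k hk => absurd hk (Nat.not_lt_zero k)⟩

theorem ncard_labellings_of_equiv {W : Type*} {r' : W} {p' m' : W → W} (e : V ≃ W)
    (her : e r = r') (hep : ∀ v, p' (e v) = e (p v)) (hem : ∀ v, m' (e v) = e (m v)) :
    (labellings r p m).ncard = (labellings r' p' m').ncard := by
  subst her
  refine (Set.ncard_congr (fun f _ => f ∘ e) ?_ ?_ ?_).symm
  · intro f hf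
    refine ⟨fun u v => ?_, fun v hv => ?_, fun v k hk => ?_⟩
    · simp only [Function.comp_apply]
      rw [hf.1, hem, e.apply_eq_iff_eq, e.apply_eq_iff_eq]
    · simp only [Function.comp_apply, ← hep]
      exact hf.2.1 _ fun h => hv (e.injective h)
    · obtain ⟨u, hu⟩ := hf.2.2 _ k hk
      exact ⟨e.symm u, by simpa using hu⟩
  · intro f g _ _ hfg
    exact e.surjective.injective_comp_right hfg
  · intro f hf
    refine ⟨f ∘ e.symm, ⟨fun u v => ?_, fun v hv => ?_, fun v k hk => ?_⟩, ?_⟩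
    · obtain ⟨u, rfl⟩ := e.surjective u
      obtain ⟨v, rfl⟩ := e.surjective v
      simp [hf.1, hem]
    · obtain ⟨v, rfl⟩ := e.surjective v
      simpa [hep] using hf.2.1 v fun h => hv (congrArg e h)
    · obtain ⟨u, hu⟩ := hf.2.2 _ k hk
      exact ⟨e u, by simpa using hu⟩
    · ext v; simp

theorem ncard_labellings_top (h : IsRooted r p) (hm : ∀ v, m (m v) = v) {v : V}
    (hvr : v ≠ r) (hmvr : m v ≠ r) (hv : ∀ w, p w = v → w = v)
    (hmv : ∀ w, p w = m v → w = m v) {W : Type*} [Finite W] {r' : W} {p' m' : W → W}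
    {e : W → V} (he : Function.Injective e) (her : e r' = r)
    (hrange : Set.range e = {u | u ≠ v ∧ u ≠ m v})
    (hep : ∀ w, p (e w) = e (p' w)) (hem : ∀ w, m (e w) = e (m' w)) :
    {f ∈ labellings r p m | ∀ u, f u ≤ f v}.ncard = (labellings r' p' m').ncard := by
  classical
  have hmem : ∀ u, u ≠ v → u ≠ m v → ∃ w, e w = u := fun u h1 h2 => by
    have : u ∈ Set.range e := by rw [hrange]; exact ⟨h1, h2⟩
    exact this
  have hnot : ∀ w, e w ≠ v ∧ e w ≠ m v := fun w => by
    have : e w ∈ Set.range e := ⟨w, rfl⟩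
    rw [hrange] at this
    exact this
  have hp : ∀ u, p u ≠ v ∧ p u ≠ m v := by
    refine fun u => ⟨fun hu => ?_, fun hu => ?_⟩
    · rw [hv u hu] at hu
      exact hvr (h.eq_root_of_periodic one_pos hu)
    · rw [hmv u hu] at hu
      exact hmvr (h.eq_root_of_periodic one_pos hu)
  have hagree : ∀ f ∈ labellings r p m, ∀ g ∈ labellings r p m, (∀ u, g u ≤ g v) →
      (∀ w, f (e w) = g (e w)) → g v ≤ f v := by
    intro f hf g hg hgv hfg
    by_contra! hlt
    obtain ⟨u, hu⟩ := hg.2.2 v _ hlt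
    obtain ⟨w, rfl⟩ := hmem u (fun hu' => by rw [hu'] at hu; omega)
      (fun hu' => by rw [hu', apply_mate_of_mem_labellings hg] at hu; omega)
    rw [← hfg, hf.1] at hu
    exact hu.elim (hnot w).1 (hnot w).2
  refine Set.ncard_congr (fun f _ => f ∘ e) ?_ ?_ ?_
  · rintro f ⟨hf, hfv⟩
    refine ⟨fun u w => ?_, fun w hw => ?_, fun w k hk => ?_⟩
    · simp only [Function.comp_apply]
      rw [hf.1, hem, he.eq_iff, he.eq_iff]
    · simp only [Function.comp_apply, ← hep]
      exact hf.2.1 _ fun h => hw (he (h.trans her.symm))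
    · obtain ⟨u, hu⟩ := hf.2.2 _ k hk
      have hlt : f u < f v := by
        rw [hu]; exact lt_of_lt_of_le hk (hfv _)
      obtain ⟨w, rfl⟩ := hmem u (fun hu' => by rw [hu'] at hlt; omega)
        (fun hu' => by rw [hu', apply_mate_of_mem_labellings hf] at hlt; omega)
      exact ⟨w, hu⟩
  · rintro f g ⟨hf, hfv⟩ ⟨hg, hgv⟩ hfg
    have hfge : ∀ w, f (e w) = g (e w) := fun w => congrFun hfg w
    have htop : f v = g v := le_antisymm (hagree g hg f hf hfv fun w => (hfge w).symm)
      (hagree f hf g hg hgv hfge)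
    funext u
    by_cases h1 : u = v
    · rw [h1, htop]
    by_cases h2 : u = m v
    · rw [h2, apply_mate_of_mem_labellings hf, apply_mate_of_mem_labellings hg, htop]
    · obtain ⟨w, rfl⟩ := hmem u h1 h2
      exact hfge w
  · intro g hg
    have : Nonempty W := ⟨r'⟩
    obtain ⟨w₀, hw₀⟩ := Finite.exists_max g
    set f : V → ℕ := fun u => if hu : ∃ w, e w = u then g hu.choose else g w₀ + 1 with hfdef
    have hfe : ∀ w, f (e w) = g w := by
      intro w
      have hex : ∃ w', e w' = e w := ⟨w, rfl⟩
      simp only [hfdef, dif_pos hex]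
      rw [he hex.choose_spec]
    have hfv : f v = g w₀ + 1 := dif_neg fun ⟨w, hw⟩ => (hnot w).1 hw
    have hfmv : f (m v) = g w₀ + 1 := dif_neg fun ⟨w, hw⟩ => (hnot w).2 hw
    have hlt : ∀ w, f (e w) < g w₀ + 1 := fun w => by
      rw [hfe]; exact Nat.lt_succ_of_le (hw₀ w)
    have hcases : ∀ u, (u = v ∨ u = m v) ∨ ∃ w, e w = u := by
      intro u
      by_cases h1 : u = v
      · exact Or.inl (Or.inl h1)
      by_cases h2 : u = m v
      · exact Or.inl (Or.inr h2)
      · exact Or.inr (hmem u h1 h2)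
    have htop : ∀ u, u = v ∨ u = m v → f u = g w₀ + 1 := by
      rintro u (rfl | rfl)
      exacts [hfv, hfmv]
    have hmtop : ∀ u, u = v ∨ u = m v → m u = v ∨ m u = m v := by
      rintro u (rfl | rfl)
      exacts [Or.inr rfl, Or.inl (hm v)]
    refine ⟨f, ⟨⟨fun u w => ?_, fun u hu => ?_, fun u k hk => ?_⟩, fun u => ?_⟩, ?_⟩
    · rcases hcases u with hu | ⟨u, rfl⟩ <;> rcases hcases w with hw | ⟨w, rfl⟩
      · rw [htop u hu, htop w hw]
        refine iff_of_true rfl ?_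
        rcases hu with rfl | rfl <;> rcases hw with rfl | rfl <;> simp [hm]
      · rw [htop u hu]
        refine iff_of_false (hlt w).ne' ?_
        rw [hem]
        rintro (rfl | rfl)
        · exact hu.elim (hnot w).1 (hnot w).2
        · exact hu.elim (hnot _).1 (hnot _).2
      · rw [htop w hw]
        refine iff_of_false (hlt u).ne ?_
        rintro (rfl | hu)
        · exact hw.elim (hnot u).1 (hnot u).2
        · exact (hmtop w hw).elim (fun h' => (hnot u).1 (hu.trans h'))
            (fun h' => (hnot u).2 (hu.trans h'))
      · rw [hfe, hfe, hg.1, hem, he.eq_iff, he.eq_iff]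
    · rcases hcases u with hu' | ⟨u, rfl⟩
      · rw [htop u hu']
        obtain ⟨w, hw⟩ := hmem (p u) (hp u).1 (hp u).2
        rw [← hw]
        exact hlt w
      · rw [hep, hfe, hfe]
        exact hg.2.1 u fun h' => hu (by rw [h', her])
    · have hk' : k < g w₀ + 1 := by
        rcases hcases u with hu' | ⟨u, rfl⟩
        · rwa [htop u hu'] at hk
        · exact hk.trans (hlt u)
      rcases Nat.lt_succ_iff_lt_or_eq.1 hk' with h1 | rfl
      · obtain ⟨w, hw⟩ := hg.2.2 _ _ h1
        exact ⟨e w, (hfe w).trans hw⟩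
      · exact ⟨e w₀, hfe w₀⟩
    · rw [hfv]
      rcases hcases u with hu' | ⟨u, rfl⟩
      · rw [htop u hu']
      · exact (hlt u).le
    · funext w
      exact hfe w

theorem ncard_labellings_eq_sum [Fintype V] [Nontrivial V] (h : IsRooted r p) (I : Finset V)
    (hI : ∀ v, v ≠ r → (∀ w, p w = v → w = v) → (∀ w, p w = m v → w = m v) →
      ∃ i ∈ I, i = v ∨ i = m v)
    (hI' : ∀ i ∈ I, ∀ j ∈ I, i = m j → i = j) :
    (labellings r p m).ncard =
      ∑ i ∈ I, {f ∈ labellings r p m | ∀ u, f u ≤ f i}.ncard := by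
  refine ncard_eq_sum_of_existsUnique finite_labellings I (fun i f => ∀ u, f u ≤ f i) ?_
  intro f hf
  obtain ⟨v, hv⟩ := Finite.exists_max f
  have hleaf : ∀ x, f x = f v → ∀ w, p w = x → w = x := by
    intro x hx w hw
    by_cases hwr : w = r
    · rw [← hw, hwr, h.root]
    · have := hf.2.1 w hwr
      rw [hw, hx] at this
      exact absurd (hv w) this.not_ge
  have hvr : v ≠ r := by
    rintro rfl
    obtain ⟨u, hu⟩ := exists_ne v
    obtain ⟨k, hk⟩ := h.reach u
    have hk0 : 0 < k := Nat.pos_of_ne_zero fun h0 => hu (by rw [h0] at hk; exact hk)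
    have := apply_iterate_lt_of_mem_labellings h hf hk0 hu
    rw [hk] at this
    exact absurd (hv u) this.not_ge
  have hfm := apply_mate_of_mem_labellings hf v
  obtain ⟨i, hiI, hi⟩ := hI v hvr (hleaf v rfl) (hleaf _ hfm)
  have hfi : f i = f v := by
    rcases hi with rfl | rfl
    exacts [rfl, hfm]
  refine ⟨i, ⟨hiI, fun u => hfi ▸ hv u⟩, ?_⟩
  rintro j ⟨hjI, hj⟩
  rcases (hf.1 j i).1 (le_antisymm (by rw [hfi]; exact hv j) (hj i)) with heq | heq
  · exact heq
  · exact hI' j hjI i hiI heq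

end Labellings

section Hook

open Classical in
theorem card_descendants_of_removal {V W : Type*} [Fintype V] [Fintype W] {p : V → V} {q : W → W}
    {e : W → V} (he : Function.Injective e) {l : V} (hrange : ∀ u, (∃ w, e w = u) ↔ u ≠ l)
    (hep : ∀ w, p (e w) = e (q w)) (w : W) :
    ((descendants q w).card : ℚ) =
      (descendants p (e w)).card - if l ∈ descendants p (e w) then 1 else 0 := by
  have hit : ∀ k w, p^[k] (e w) = e (q^[k] w) := by
    intro k
    induction k with
    | zero => exact fun _ => rfl
    | succ k ih => intro w; rw [Function.iterate_succ_apply, Function.iterate_succ_apply, hep, ih]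
  have himage : (descendants q w).image e = (descendants p (e w)).erase l := by
    ext u
    simp only [Finset.mem_image, mem_descendants, Finset.mem_erase]
    constructor
    · rintro ⟨w', ⟨k, rfl⟩, rfl⟩
      exact ⟨(hrange _).1 ⟨_, rfl⟩, k, hit k w'⟩
    · rintro ⟨hul, k, hk⟩
      obtain ⟨w', rfl⟩ := (hrange u).2 hul
      exact ⟨w', ⟨k, he (by rw [← hit, hk])⟩, rfl⟩
  rw [← Finset.card_image_of_injective _ he, himage, Finset.card_erase_eq_ite]
  split_ifs
  · rw [Nat.cast_sub (card_descendants_pos _), Nat.cast_one]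
  · rw [sub_zero]

/-- The hook length formula for rooted trees. -/
theorem ncard_labellings_id (n : ℕ) {V : Type*} [Fintype V] {r : V} {p : V → V}
    (h : IsRooted r p) (hn : Fintype.card V = n + 1) :
    ((labellings r p id).ncard : ℚ) =
      (n + 1).factorial / ∏ v, ((descendants p v).card : ℚ) := by
  classical
  induction n generalizing V with
  | zero =>
    have : Subsingleton V := Fintype.card_le_one_iff_subsingleton.1 hn.le
    have hd : ∀ v, (descendants p v).card = 1 := fun v =>
      le_antisymm ((Finset.card_le_univ _).trans_eq hn) (card_descendants_pos v)
    rw [labellings_subsingleton_eq fun v => Subsingleton.elim v r]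
    simp [hd]
  | succ n ih =>
    have : Nontrivial V := Fintype.one_lt_card_iff_nontrivial.1 (by omega)
    set I : Finset V := Finset.univ.filter fun l => childrenOf p l = ∅ with hI
    have hleaf : ∀ l, childrenOf p l = ∅ ↔ ∀ w, p w = l → w = l := by
      intro l
      simp only [Finset.eq_empty_iff_forall_notMem, mem_childrenOf, not_and, not_not]
    rw [ncard_labellings_eq_sum (m := id) h I
      (fun v _ hv _ => ⟨v, by simpa [hI, hleaf] using hv, Or.inl rfl⟩) (fun _ _ _ _ he => he),
      Nat.cast_sum]
    have hpos : ∀ v, ((descendants p v).card : ℚ) ≠ 0 := fun v =>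
      Nat.cast_ne_zero.2 (card_descendants_pos v).ne'
    have key : ∀ l ∈ I, (({f ∈ labellings r p id | ∀ u, f u ≤ f l}.ncard : ℕ) : ℚ) =
        (n + 1).factorial / (∏ v, ((descendants p v).card : ℚ)) *
        ∏ u, (if l ∈ descendants p u ∧ u ≠ l then
          ((descendants p u).card : ℚ) / ((descendants p u).card - 1) else 1) := by
      intro l hl
      have hchild : childrenOf p l = ∅ := (Finset.mem_filter.1 hl).2
      have hll := (hleaf l).1 hchild
      have hone := (card_descendants_eq_one_iff h l).2 hchild
      have hlr : r ≠ l := by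
        rintro rfl
        rw [descendants_root h, Finset.card_univ] at hone
        omega
      let q : {u // u ≠ l} → {u // u ≠ l} := fun u => ⟨p u, fun hu => u.2 (hll u hu)⟩
      have hit : ∀ k (u : {u // u ≠ l}), ((q^[k] u : {u // u ≠ l}) : V) = p^[k] u := by
        intro k
        induction k with
        | zero => exact fun _ => rfl
        | succ k ih => intro u; rw [Function.iterate_succ_apply, Function.iterate_succ_apply, ih]
      have hq : IsRooted (⟨r, hlr⟩ : {u // u ≠ l}) q := by
        refine ⟨Subtype.ext h.root, fun v => ?_⟩
        obtain ⟨k, hk⟩ := h.reach v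
        exact ⟨k, Subtype.ext ((hit k v).trans hk)⟩
      have hcard : Fintype.card {u // u ≠ l} = n + 1 := by
        rw [Fintype.card_subtype_compl, hn, Fintype.card_subtype_eq]
        rfl
      rw [ncard_labellings_top (m := id) (m' := id) (e := Subtype.val) h (fun _ => rfl) hlr.symm
        hlr.symm hll hll Subtype.val_injective (r' := ⟨r, hlr⟩) (p' := q) rfl (by ext; simp)
        (fun _ => rfl) (fun _ => rfl), ih hq hcard]
      rw [Fintype.prod_eq_mul_prod_subtype_ne (fun v => ((descendants p v).card : ℚ)) l,
        Fintype.prod_eq_mul_prod_subtype_ne _ l, hone, if_neg (fun hh => hh.2 rfl), Nat.cast_one,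
        one_mul, one_mul, div_eq_mul_inv, div_mul_eq_mul_div, mul_div_assoc,
        ← Finset.prod_div_distrib, ← Finset.prod_inv_distrib]
      congr 1
      refine Finset.prod_congr rfl fun w _ => ?_
      rw [card_descendants_of_removal (p := p) Subtype.val_injective (l := l) (by simp)
        (fun _ => rfl) w]
      by_cases hw : l ∈ descendants p w
      · rw [if_pos hw, if_pos ⟨hw, w.2⟩, div_right_comm, div_self (hpos _), one_div]
      · rw [if_neg hw, if_neg fun hh => hw hh.1, sub_zero, one_div]
    rw [Finset.sum_congr rfl key, ← Finset.mul_sum]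
    have hsum := sum_leaves_descendants h r
    rw [descendants_root h, ← Finset.sum_filter, ← hI, Finset.card_univ, hn] at hsum
    rw [hsum, Nat.factorial_succ (n + 1)]
    push_cast
    ring

end Hook

theorem exists_equiv_fin_apply_zero {W : Type*} [Fintype W] (x : W) :
    ∃ n, Fintype.card W = n + 1 ∧ ∃ e : Fin (n + 1) ≃ W, e 0 = x := by
  classical
  obtain ⟨n, hn⟩ := Nat.exists_eq_succ_of_ne_zero (Fintype.card_pos_iff.2 ⟨x⟩).ne'
  refine ⟨n, hn, (Equiv.swap 0 ((Fintype.equivFinOfCardEq hn) x)).trans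
    (Fintype.equivFinOfCardEq hn).symm, ?_⟩
  simp

theorem IsRooted.conj {V W : Type*} {r : W} {q : W → W} (h : IsRooted r q) (e : V ≃ W) :
    IsRooted (e.symm r) fun v => e.symm (q (e v)) := by
  refine ⟨by simp [h.root], fun v => ?_⟩
  obtain ⟨k, hk⟩ := h.reach (e v)
  refine ⟨k, ?_⟩
  have hs : Function.Semiconj e.symm q fun v => e.symm (q (e v)) := fun w => by simp
  have := hs.iterate_right k (e v)
  rw [e.symm_apply_apply] at this
  rw [← this, hk]

namespace PTree

theorem isRooted (s : PTree) : IsRooted 0 s.parent :=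
  ⟨s.parent_root, fun v => ⟨s.n, s.reaches_root v⟩⟩

theorem exists_isSubtreeAt (s : PTree) (c : Fin (s.n + 1)) : ∃ s', s.IsSubtreeAt c s' := by
  classical
  let W := {u : Fin (s.n + 1) // ∃ k, s.parent^[k] u = c}
  have hW : ∀ u : W, u.1 ≠ c → ∃ k, s.parent^[k] (s.parent u.1) = c := by
    rintro ⟨u, k, hk⟩ hu
    cases k with
    | zero => exact absurd hk hu
    | succ k => exact ⟨k, hk⟩
  let q : W → W := fun u => if hu : u.1 = c then u else ⟨s.parent u.1, hW u hu⟩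
  let x : W := ⟨c, 0, rfl⟩
  have hq : IsRooted x q := by
    refine ⟨dif_pos rfl, ?_⟩
    rintro ⟨u, k, hk⟩
    induction k generalizing u with
    | zero => exact ⟨0, Subtype.ext hk⟩
    | succ k ih =>
      by_cases hu : u = c
      · exact ⟨0, Subtype.ext hu⟩
      · obtain ⟨j, hj⟩ := ih (s.parent u) hk
        refine ⟨j + 1, ?_⟩
        rw [Function.iterate_succ_apply, ← hj]
        congr 1
        exact dif_neg hu
  obtain ⟨n, hn, e, he⟩ := exists_equiv_fin_apply_zero x
  have hroot := hq.conj e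
  rw [← he, e.symm_apply_apply] at hroot
  refine ⟨⟨n, _, hroot.root, fun v => hroot.iterate_card (Fintype.card_fin _) v⟩,
    e.toEmbedding.trans (Function.Embedding.subtype _), congrArg Subtype.val he, ?_, ?_⟩
  · ext u
    constructor
    · rintro ⟨w, rfl⟩
      exact (e w).2
    · intro hu
      exact ⟨e.symm ⟨u, hu⟩, congrArg Subtype.val (e.apply_symm_apply _)⟩
  · intro w hw
    have hwc : (e w).1 ≠ c := fun hh => hw (e.injective (by rw [he]; exact Subtype.ext hh))
    change s.parent (e w).1 = (e (e.symm (q (e w)))).1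
    rw [e.apply_symm_apply]
    have hqe : q (e w) = ⟨s.parent (e w).1, hW _ hwc⟩ := dif_neg hwc
    rw [hqe]

theorem prod_card_descendants_of_isSubtreeAt {s : PTree} {c : Fin (s.n + 1)} (hc : c ≠ 0)
    {s' : PTree} (h : s.IsSubtreeAt c s') :
    ∏ w, (descendants s'.parent w).card =
      ∏ u ∈ descendants s.parent c, (descendants s.parent u).card := by
  classical
  obtain ⟨e, he0, hrange, hep⟩ := h
  have hrange' : Finset.univ.map e = descendants s.parent c := by
    ext u
    have := Set.ext_iff.1 hrange u
    simpa using this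
  rw [← hrange', Finset.prod_map]
  refine Finset.prod_congr rfl fun w _ => ?_
  rw [← Finset.card_map e]
  congr 1
  ext u
  simp only [Finset.mem_map, mem_descendants]
  constructor
  · rintro ⟨v, ⟨k, hk⟩, rfl⟩
    induction k generalizing v with
    | zero => exact ⟨0, congrArg e hk⟩
    | succ k ih =>
      by_cases hv : v = 0
      · refine ⟨0, congrArg e ?_⟩
        rw [hv, Function.iterate_fixed s'.parent_root] at hk
        rw [hv]
        exact hk
      · obtain ⟨j, hj⟩ := ih _ hk
        exact ⟨j + 1, by rw [Function.iterate_succ_apply, hep v hv, hj]⟩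
  · rintro ⟨k, hk⟩
    have hew : e w ∈ descendants s.parent c := hrange' ▸ Finset.mem_map_of_mem e (Finset.mem_univ w)
    have huc : u ∈ descendants s.parent c := descendants_trans hew (mem_descendants.2 ⟨k, hk⟩)
    rw [← hrange'] at huc
    obtain ⟨v, -, rfl⟩ := Finset.mem_map.1 huc
    refine ⟨v, ?_, rfl⟩
    induction k generalizing v with
    | zero => exact ⟨0, e.injective hk⟩
    | succ k ih =>
      by_cases hv : v = 0
      · obtain ⟨j, hj⟩ := mem_descendants.1 hew
        rw [hv, he0] at hk
        refine absurd (s.isRooted.eq_root_of_periodic (k := j + (k + 1)) (by omega) ?_) hc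
        rw [Function.iterate_add_apply, hk, hj]
      · rw [Function.iterate_succ_apply, hep v hv] at hk
        obtain ⟨j, hj⟩ := ih _ hk (Finset.mem_map_of_mem e (Finset.mem_univ _))
        exact ⟨j + 1, hj⟩

theorem n_lt_of_isSubtreeAt {s : PTree} {c : Fin (s.n + 1)} (hc : c ≠ 0) {s' : PTree}
    (h : s.IsSubtreeAt c s') : s'.n < s.n := by
  obtain ⟨e, -, hrange, -⟩ := h
  have hmem : ∀ w, e w ≠ 0 := by
    intro w h0
    have : e w ∈ Set.range e := ⟨w, rfl⟩
    rw [hrange, h0] at this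
    obtain ⟨k, hk⟩ := this
    rw [s.isRooted.iterate_root] at hk
    exact hc hk.symm
  have hcard : (Finset.univ.map e).card < (Finset.univ : Finset (Fin (s.n + 1))).card := by
    refine Finset.card_lt_card (Finset.ssubset_univ_iff.2 fun hu => ?_)
    have : (0 : Fin (s.n + 1)) ∈ Finset.univ.map e := hu ▸ Finset.mem_univ _
    obtain ⟨w, -, hw⟩ := Finset.mem_map.1 this
    exact hmem w hw
  rw [Finset.card_map, Finset.card_univ, Finset.card_univ, Fintype.card_fin,
    Fintype.card_fin] at hcard
  omega

theorem factorial_eq_prod {pfac : PTree → ℕ} (hpfac : IsPlainFactorial pfac) (s : PTree) :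
    pfac s = ∏ v, (descendants s.parent v).card := by
  induction s using (measure PTree.n).wf.induction with
  | _ s ih =>
  rcases Nat.eq_zero_or_pos s.n with h0 | hpos
  · rw [hpfac.1 s h0]
    refine (Finset.prod_eq_one fun v _ => le_antisymm ?_ (card_descendants_pos v)).symm
    refine (Finset.card_le_univ _).trans ?_
    simp [h0]
  · choose st hst using fun (c : Fin (s.n + 1)) (_ : c ∈ s.rootChildren) => s.exists_isSubtreeAt c
    have hne : ∀ c ∈ s.rootChildren, c ≠ 0 := fun c hc => (Finset.mem_filter.1 hc).2.2
    rw [hpfac.2 s hpos st hst, ← descendants_root s.isRooted, prod_descendants s.isRooted,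
      descendants_root s.isRooted, Finset.card_univ, Fintype.card_fin]
    congr 1
    have hch : childrenOf s.parent 0 = s.rootChildren := by
      ext c
      simp [rootChildren]
    rw [hch]
    refine (Finset.prod_congr rfl fun c _ => ?_).trans (Finset.prod_attach s.rootChildren
      fun c => ∏ u ∈ descendants s.parent c, (descendants s.parent u).card)
    rw [ih _ (n_lt_of_isSubtreeAt (hne _ c.2) (hst c.1 c.2)),
      prod_card_descendants_of_isSubtreeAt (hne _ c.2) (hst c.1 c.2)]

end PTree

namespace ExoticTree

theorem isRooted (t : ExoticTree) : IsRooted 0 t.parent :=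
  ⟨t.parent_root, fun v => ⟨t.n, t.reaches_root v⟩⟩

theorem mate_mate (t : ExoticTree) (v : Fin (t.n + 1)) : t.mate (t.mate v) = v := by
  by_cases hv : t.colour v = some XColour.beta
  · exact (t.mate_beta v hv).2.1
  · rw [t.mate_nonbeta v hv, t.mate_nonbeta v hv]

theorem mate_involutive (t : ExoticTree) : Function.Involutive t.mate := t.mate_mate

theorem colour_mate (t : ExoticTree) (v : Fin (t.n + 1)) : t.colour (t.mate v) = t.colour v := by
  by_cases hv : t.colour v = some XColour.beta
  · rw [hv, (t.mate_beta v hv).1]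
  · rw [t.mate_nonbeta v hv]

theorem ne_zero_of_colour {t : ExoticTree} {v : Fin (t.n + 1)} {c : XColour}
    (hv : t.colour v = some c) : v ≠ 0 := by
  rintro rfl
  rw [t.colour_root] at hv
  cases hv

theorem mate_zero (t : ExoticTree) : t.mate 0 = 0 :=
  t.mate_nonbeta 0 (by rw [t.colour_root]; exact nofun)

theorem mate_ne_zero {t : ExoticTree} {v : Fin (t.n + 1)} (hv : v ≠ 0) : t.mate v ≠ 0 := by
  intro h0
  rw [← t.mate_mate v, h0, t.mate_zero] at hv
  exact hv rfl

/-- Twice the contribution of a vertex to the effective size. -/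
def colourWeight : Option XColour → ℕ
  | some XColour.beta => 1
  | _ => 2

theorem two_mul_effSize (t : ExoticTree) :
    2 * t.effSize = ∑ v, colourWeight (t.colour v) := by
  have hlt : ∑ v, (if t.colour v = some XColour.beta ∧ v < t.mate v then 1 else 0) =
      ∑ v, (if t.colour v = some XColour.beta ∧ t.mate v < v then 1 else 0) := by
    refine Fintype.sum_equiv (Function.Involutive.toPerm t.mate t.mate_involutive) _ _ fun v => ?_
    simp [t.mate_mate, t.colour_mate]
  have hsplit : ∀ v, colourWeight (t.colour v) = (if v = 0 then 2 else 0) +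
      2 * (if t.colour v = some XColour.alpha then 1 else 0) +
      (if t.colour v = some XColour.beta ∧ v < t.mate v then 1 else 0) +
      (if t.colour v = some XColour.beta ∧ t.mate v < v then 1 else 0) := by
    intro v
    by_cases h0 : v = 0
    · subst h0
      simp [t.colour_root, colourWeight]
    · match hc : t.colour v with
      | none => exact absurd hc (t.colour_nonroot v h0)
      | some XColour.alpha => simp [h0, colourWeight]
      | some XColour.beta =>
        rcases lt_or_gt_of_ne (t.mate_beta v hc).2.2 with h | h <;>
          simp [h0, colourWeight, h, h.not_gt]
  rw [Finset.sum_congr rfl fun v _ => hsplit v]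
  simp only [Finset.sum_add_distrib, ← Finset.mul_sum, ← hlt]
  rw [← Finset.card_filter, ← Finset.card_filter, Finset.sum_ite_eq' Finset.univ 0,
    if_pos (Finset.mem_univ _), effSize, numAlpha, numPairs]
  ring

theorem exists_removal (t : ExoticTree) {v : Fin (t.n + 1)} (hv0 : v ≠ 0) (hv : t.IsLeaf v)
    (hmv : t.IsLeaf (t.mate v)) :
    ∃ (t' : ExoticTree) (e : Fin (t'.n + 1) ↪ Fin (t.n + 1)), e 0 = 0 ∧
      Set.range e = {u | u ≠ v ∧ u ≠ t.mate v} ∧ (∀ w, t.colour (e w) = t'.colour w) ∧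
      (∀ w, t.parent (e w) = e (t'.parent w)) ∧ ∀ w, t.mate (e w) = e (t'.mate w) := by
  have hleaf : ∀ x, x ≠ 0 → t.IsLeaf x → ∀ u, t.parent u ≠ x := by
    intro x hx hlx u hu
    have := hlx u hu
    rw [this] at hu
    exact hx (t.isRooted.eq_root_of_periodic one_pos hu)
  let W := {u : Fin (t.n + 1) // u ≠ v ∧ u ≠ t.mate v}
  let x : W := ⟨0, hv0.symm, (mate_ne_zero hv0).symm⟩
  let q : W → W := fun u => ⟨t.parent u.1, hleaf v hv0 hv _, hleaf _ (mate_ne_zero hv0) hmv _⟩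
  let m : W → W := fun u => ⟨t.mate u.1,
    fun h => u.2.2 ((t.mate_mate u.1).symm.trans (congrArg t.mate h)),
    fun h => u.2.1 (by rw [← t.mate_mate u.1, h, t.mate_mate])⟩
  have hq : IsRooted x q := by
    refine ⟨Subtype.ext t.parent_root, ?_⟩
    intro u
    obtain ⟨k, hk⟩ := t.isRooted.reach u.1
    have hs : Function.Semiconj Subtype.val q t.parent := fun _ => rfl
    exact ⟨k, Subtype.ext ((hs.iterate_right k u).trans hk)⟩
  obtain ⟨n, hn, e, he⟩ := exists_equiv_fin_apply_zero x
  have hroot := hq.conj e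
  rw [← he, e.symm_apply_apply] at hroot
  have he0 : (e 0).1 = 0 := congrArg Subtype.val he
  refine ⟨⟨n, _, fun w => t.colour (e w).1, fun w => e.symm (m (e w)), hroot.root,
    fun w => hroot.iterate_card (Fintype.card_fin _) w, ?_, ?_, ?_, ?_⟩,
    ⟨fun w => (e w).1, Subtype.val_injective.comp e.injective⟩, he0, ?_, fun _ => rfl, ?_, ?_⟩
  · rw [he0, t.colour_root]
  · intro w hw
    refine t.colour_nonroot _ fun h => hw (e.injective ?_)
    rw [he]
    exact Subtype.ext h
  · intro w hw
    obtain ⟨h1, h2, h3⟩ := t.mate_beta _ hw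
    refine ⟨?_, ?_, ?_⟩
    · rw [e.apply_symm_apply]
      exact h1
    · rw [e.apply_symm_apply, e.symm_apply_eq]
      exact Subtype.ext h2
    · rw [Ne, e.symm_apply_eq]
      exact fun h => h3 (congrArg Subtype.val h)
  · intro w hw
    rw [e.symm_apply_eq]
    exact Subtype.ext (t.mate_nonbeta _ hw)
  · ext u
    constructor
    · rintro ⟨w, rfl⟩
      exact (e w).2
    · intro hu
      exact ⟨e.symm ⟨u, hu⟩, congrArg Subtype.val (e.apply_symm_apply _)⟩
  · intro w
    exact congrArg Subtype.val (e.apply_symm_apply (q (e w))).symm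
  · intro w
    exact congrArg Subtype.val (e.apply_symm_apply (m (e w))).symm

theorem effSize_of_removal {t t' : ExoticTree} {v : Fin (t.n + 1)} (hv0 : v ≠ 0)
    (e : Fin (t'.n + 1) ↪ Fin (t.n + 1)) (hrange : Set.range e = {u | u ≠ v ∧ u ≠ t.mate v})
    (hcol : ∀ w, t.colour (e w) = t'.colour w) : t.effSize = t'.effSize + 1 := by
  have hmap : Finset.univ.map e = ({v, t.mate v} : Finset _)ᶜ := by
    ext u
    have := Set.ext_iff.1 hrange u
    simpa using this
  have h := t.two_mul_effSize
  rw [← Finset.sum_compl_add_sum {v, t.mate v}, ← hmap, Finset.sum_map,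
    Finset.sum_congr rfl fun w _ => congrArg colourWeight (hcol w), ← t'.two_mul_effSize] at h
  have hpair : ∑ u ∈ {v, t.mate v}, colourWeight (t.colour u) = 2 := by
    match hc : t.colour v with
    | none => exact absurd hc (t.colour_nonroot v hv0)
    | some XColour.alpha =>
      rw [t.mate_nonbeta v (by rw [hc]; exact nofun)]
      simp [hc, colourWeight]
    | some XColour.beta =>
      rw [Finset.sum_pair (t.mate_beta v hc).2.2.symm, t.colour_mate, hc]
      rfl
  omega

theorem n_lt_of_removal {t t' : ExoticTree} {v : Fin (t.n + 1)}
    (e : Fin (t'.n + 1) ↪ Fin (t.n + 1)) (hrange : Set.range e = {u | u ≠ v ∧ u ≠ t.mate v}) :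
    t'.n < t.n := by
  have hcard : (Finset.univ.map e).card < (Finset.univ : Finset (Fin (t.n + 1))).card := by
    refine Finset.card_lt_card (Finset.ssubset_univ_iff.2 fun hu => ?_)
    obtain ⟨w, -, hw⟩ := Finset.mem_map.1 (hu ▸ Finset.mem_univ v)
    have : v ∈ Set.range e := ⟨w, hw⟩
    rw [hrange] at this
    exact this.1 rfl
  rw [Finset.card_map, Finset.card_univ, Finset.card_univ, Fintype.card_fin,
    Fintype.card_fin] at hcard
  omega

/-- The number of increasing labellings of an exotic coloured tree in which paired vertices
share a label. -/
noncomputable def numLabellings (t : ExoticTree) : ℕ := (labellings 0 t.parent t.mate).ncard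

theorem factorial_effSize_div {efac : ExoticTree → ℚ} (hefac : IsTreeFactorial efac)
    (t : ExoticTree) : (t.effSize.factorial : ℚ) / efac t = t.numLabellings := by
  induction t using (measure ExoticTree.n).wf.induction with
  | _ t ih =>
  rcases Nat.eq_zero_or_pos t.n with h0 | hpos
  · have : Subsingleton (Fin (t.n + 1)) :=
      Fin.subsingleton_iff_le_one.2 (by omega)
    have hsize : t.effSize = 1 := by
      have h2 := t.two_mul_effSize
      rw [Fintype.sum_subsingleton _ 0, t.colour_root, colourWeight] at h2
      · omega
      · exact nofun
    rw [hefac.1 t h0, hsize, numLabellings,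
      labellings_subsingleton_eq fun v => Subsingleton.elim v 0]
    simp
  have : Nontrivial (Fin (t.n + 1)) := Fin.nontrivial_iff_two_le.2 (by omega)
  have hα : ∀ v ∈ t.alphaLeaves, t.colour v = some XColour.alpha ∧ t.IsLeaf v ∧
      t.mate v = v := by
    intro v hv
    obtain ⟨-, h1, h2⟩ := Finset.mem_filter.1 hv
    exact ⟨h1, h2, t.mate_nonbeta v (by rw [h1]; exact nofun)⟩
  have hβ : ∀ v ∈ t.betaLeafPairs, t.colour v = some XColour.beta ∧ v < t.mate v ∧ t.IsLeaf v ∧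
      t.IsLeaf (t.mate v) := fun v hv => (Finset.mem_filter.1 hv).2
  have hexα : ∀ v (_ : v ∈ t.alphaLeaves), ∃ t', t.IsAlphaLeafRemoval v t' := by
    intro v hv
    obtain ⟨h1, h2, h3⟩ := hα v hv
    obtain ⟨t', e, he0, hr, hrest⟩ := t.exists_removal (ne_zero_of_colour h1) h2 (h3.symm ▸ h2)
    exact ⟨t', h1, h2, e, he0, by rw [hr, h3]; simp, hrest⟩
  have hexβ : ∀ v (_ : v ∈ t.betaLeafPairs), ∃ t', t.IsBetaPairLeafRemoval v t' := by
    intro v hv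
    obtain ⟨h1, -, h2, h3⟩ := hβ v hv
    obtain ⟨t', e, hrest⟩ := t.exists_removal (ne_zero_of_colour h1) h2 h3
    exact ⟨t', h1, h2, h3, e, hrest⟩
  choose rα hrα using hexα
  choose rβ hrβ using hexβ
  have hstep : ∀ (v : Fin (t.n + 1)) (t' : ExoticTree) (e : Fin (t'.n + 1) ↪ Fin (t.n + 1)),
      v ≠ 0 → t.IsLeaf v → t.IsLeaf (t.mate v) → e 0 = 0 →
      Set.range e = {u | u ≠ v ∧ u ≠ t.mate v} → (∀ w, t.colour (e w) = t'.colour w) →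
      (∀ w, t.parent (e w) = e (t'.parent w)) → (∀ w, t.mate (e w) = e (t'.mate w)) →
      ((t.effSize - 1).factorial : ℚ) * (1 / efac t') =
        {f ∈ labellings 0 t.parent t.mate | ∀ u, f u ≤ f v}.ncard := by
    intro v t' e hv0 hl hml he0 hr hcol hpar hmate
    rw [ncard_labellings_top t.isRooted t.mate_mate hv0 (mate_ne_zero hv0) hl hml e.injective he0
      hr hpar hmate, ← numLabellings, ← ih t' (n_lt_of_removal e hr),
      effSize_of_removal hv0 e hr hcol, Nat.add_sub_cancel, mul_one_div]
  have hdisj : Disjoint t.alphaLeaves t.betaLeafPairs := by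
    rw [Finset.disjoint_left]
    intro v h1 h2
    have := (hα v h1).1
    rw [(hβ v h2).1] at this
    cases this
  have hsize : t.effSize.factorial = (t.effSize - 1).factorial * t.effSize := by
    rw [mul_comm, Nat.mul_factorial_pred]
    rw [effSize]
    omega
  rw [hsize, Nat.cast_mul, mul_div_assoc, hefac.2 t hpos rα rβ hrα hrβ, mul_add, Finset.mul_sum,
    Finset.mul_sum, numLabellings,
    ncard_labellings_eq_sum t.isRooted (t.alphaLeaves ∪ t.betaLeafPairs), Finset.sum_union hdisj,
    Nat.cast_add, Nat.cast_sum, Nat.cast_sum, ← Finset.sum_attach t.alphaLeaves,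
    ← Finset.sum_attach t.betaLeafPairs]
  · congr 1
    · refine Finset.sum_congr rfl fun v _ => ?_
      obtain ⟨h1, h2, e, he0, hr, hcol, hpar, hmate⟩ := hrα v.1 v.2
      have hm := (hα v.1 v.2).2.2
      exact hstep v.1 _ e (ne_zero_of_colour h1) h2 (hm.symm ▸ h2) he0 (by rw [hr, hm]; simp)
        hcol hpar hmate
    · refine Finset.sum_congr rfl fun v _ => ?_
      obtain ⟨h1, h2, h3, e, he0, hr, hcol, hpar, hmate⟩ := hrβ v.1 v.2
      exact hstep v.1 _ e (ne_zero_of_colour h1) h2 h3 he0 hr hcol hpar hmate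
  · intro v hv0 hl hml
    match hc : t.colour v with
    | none => exact absurd hc (t.colour_nonroot v hv0)
    | some XColour.alpha =>
      exact ⟨v, Finset.mem_union_left _ (Finset.mem_filter.2 ⟨Finset.mem_univ _, hc, hl⟩),
        Or.inl rfl⟩
    | some XColour.beta =>
      obtain ⟨h1, h2, h3⟩ := t.mate_beta v hc
      rcases lt_or_gt_of_ne h3 with h | h
      · refine ⟨t.mate v, Finset.mem_union_right _ (Finset.mem_filter.2
          ⟨Finset.mem_univ _, h1, ?_, hml, ?_⟩), Or.inr rfl⟩
        · rwa [h2]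
        · rwa [h2]
      · exact ⟨v, Finset.mem_union_right _ (Finset.mem_filter.2
          ⟨Finset.mem_univ _, hc, h, hl, hml⟩), Or.inl rfl⟩
  · intro i hi j hj hij
    rcases Finset.mem_union.1 hj with hj | hj
    · rw [hij, (hα j hj).2.2]
    · rcases Finset.mem_union.1 hi with hi | hi
      · rw [← (hα i hi).2.2, hij, t.mate_mate]
      · have h1 := (hβ i hi).2.1
        have h2 := (hβ j hj).2.1
        rw [hij, t.mate_mate] at h1
        exact absurd h1 h2.not_gt

end ExoticTree

namespace ShuffleT

variable {a b : ℕ}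

theorem bijective (sh : ShuffleT a b) : Function.Bijective (Sum.elim sh.1.1 sh.1.2) := by
  rw [Fintype.bijective_iff_surjective_and_card]
  refine ⟨fun x => ?_, by simp⟩
  rcases sh.2.2.2 x with ⟨i, hi⟩ | ⟨j, hj⟩
  exacts [⟨Sum.inl i, hi⟩, ⟨Sum.inr j, hj⟩]

theorem fst_ne_snd (sh : ShuffleT a b) (i : Fin a) (j : Fin b) : sh.1.1 i ≠ sh.1.2 j := fun h =>
  Sum.inl_ne_inr (sh.bijective.1 (show Sum.elim sh.1.1 sh.1.2 (Sum.inl i) =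
    Sum.elim sh.1.1 sh.1.2 (Sum.inr j) from h))

theorem ext_of_lt_iff {sh sh' : ShuffleT a b}
    (h : ∀ i j, sh.1.1 i < sh.1.2 j ↔ sh'.1.1 i < sh'.1.2 j) : sh = sh' := by
  let e := Equiv.ofBijective _ sh.bijective
  have hmono : StrictMono fun x => Sum.elim sh'.1.1 sh'.1.2 (e.symm x) := by
    intro x y hxy
    obtain ⟨x, rfl⟩ := e.surjective x
    obtain ⟨y, rfl⟩ := e.surjective y
    simp only [Equiv.symm_apply_apply]
    have mono : ∀ s : ShuffleT a b, StrictMono s.1.1 ∧ StrictMono s.1.2 := fun s =>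
      ⟨fun i j => s.2.1 i j, fun i j => s.2.2.1 i j⟩
    rcases x with x | x <;> rcases y with y | y
    · exact (mono sh').1 ((mono sh).1.lt_iff_lt.1 hxy)
    · exact (h x y).1 hxy
    · refine lt_of_le_of_ne (not_lt.1 fun hlt => ?_) (sh'.fst_ne_snd y x).symm
      exact absurd ((h y x).2 hlt) (not_lt.2 (le_of_lt hxy))
    · exact (mono sh').2 ((mono sh).2.lt_iff_lt.1 hxy)
  have hsurj : Function.Surjective fun x => Sum.elim sh'.1.1 sh'.1.2 (e.symm x) :=
    sh'.bijective.2.comp e.symm.surjective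
  have hid : ∀ x, Sum.elim sh'.1.1 sh'.1.2 (e.symm x) = x := fun x =>
    DFunLike.congr_fun (Subsingleton.elim (hmono.orderIsoOfSurjective _ hsurj)
      (OrderIso.refl _)) x
  have hsum : ∀ s, Sum.elim sh'.1.1 sh'.1.2 s = Sum.elim sh.1.1 sh.1.2 s := fun s => by
    have := hid (e s)
    rwa [e.symm_apply_apply] at this
  exact Subtype.ext (Prod.ext (funext fun i => (hsum (Sum.inl i)).symm)
    (funext fun j => (hsum (Sum.inr j)).symm))

theorem exists_lt_iff {g : Fin a → ℕ} {h : Fin b → ℕ} (hg : Monotone g) (hh : Monotone h)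
    (hne : ∀ i j, g i ≠ h j) :
    ∃ sh : ShuffleT a b, ∀ i j, sh.1.1 i < sh.1.2 j ↔ g i < h j := by
  let P : Fin a → Finset (Fin b) := fun i => Finset.univ.filter fun j => h j < g i
  let Q : Fin b → Finset (Fin a) := fun j => Finset.univ.filter fun i => g i < h j
  have hP : ∀ i, (P i).card ≤ b := fun i => (Finset.card_le_univ _).trans_eq (Fintype.card_fin b)
  have hQ : ∀ j, (Q j).card ≤ a := fun j => (Finset.card_le_univ _).trans_eq (Fintype.card_fin a)
  have hPmono : ∀ i i', i ≤ i' → (P i).card ≤ (P i').card := fun i i' hi =>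
    Finset.card_le_card fun j hj => by
      simp only [P, Finset.mem_filter, Finset.mem_univ, true_and] at hj ⊢
      exact hj.trans_le (hg hi)
  have hQmono : ∀ j j', j ≤ j' → (Q j).card ≤ (Q j').card := fun j j' hj =>
    Finset.card_le_card fun i hi => by
      simp only [Q, Finset.mem_filter, Finset.mem_univ, true_and] at hi ⊢
      exact hi.trans_le (hh hj)
  have hPlt : ∀ i j, g i < h j → (P i).card ≤ j := fun i j hij => by
    refine (Finset.card_le_card (t := Finset.Iio j) fun j' hj' => ?_).trans_eq (by simp)
    simp only [P, Finset.mem_filter, Finset.mem_univ, true_and] at hj'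
    exact Finset.mem_Iio.2 (not_le.1 fun hle => absurd (hh hle) (by omega))
  have hQlt : ∀ i j, g i < h j → (i : ℕ) + 1 ≤ (Q j).card := fun i j hij => by
    refine (Finset.card_le_card (s := Finset.Iic i) fun i' hi' => ?_).trans_eq' (by simp)
    simp only [Q, Finset.mem_filter, Finset.mem_univ, true_and]
    exact (hg (Finset.mem_Iic.1 hi')).trans_lt hij
  have hQgt : ∀ i j, h j < g i → (Q j).card ≤ i := fun i j hij => by
    refine (Finset.card_le_card (t := Finset.Iio i) fun i' hi' => ?_).trans_eq (by simp)
    simp only [Q, Finset.mem_filter, Finset.mem_univ, true_and] at hi'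
    exact Finset.mem_Iio.2 (not_le.1 fun hle => absurd (hg hle) (by omega))
  have hPgt : ∀ i j, h j < g i → (j : ℕ) + 1 ≤ (P i).card := fun i j hij => by
    refine (Finset.card_le_card (s := Finset.Iic j) fun j' hj' => ?_).trans_eq' (by simp)
    simp only [P, Finset.mem_filter, Finset.mem_univ, true_and]
    exact (hh (Finset.mem_Iic.1 hj')).trans_lt hij
  let u : Fin a → Fin (a + b) := fun i => ⟨i + (P i).card, by have := hP i; omega⟩
  let v : Fin b → Fin (a + b) := fun j => ⟨j + (Q j).card, by have := hQ j; omega⟩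
  have hu : ∀ i i', i < i' → u i < u i' := fun i i' hi => by
    have := hPmono i i' hi.le
    exact Fin.mk_lt_mk.2 (by omega)
  have hv : ∀ j j', j < j' → v j < v j' := fun j j' hj => by
    have := hQmono j j' hj.le
    exact Fin.mk_lt_mk.2 (by omega)
  have huv : ∀ i j, g i < h j → u i < v j := fun i j hij => by
    have := hPlt i j hij
    have := hQlt i j hij
    exact Fin.mk_lt_mk.2 (by omega)
  have hvu : ∀ i j, h j < g i → v j < u i := fun i j hij => by
    have := hQgt i j hij
    have := hPgt i j hij
    exact Fin.mk_lt_mk.2 (by omega)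
  have huvne : ∀ i j, u i ≠ v j := fun i j =>
    (lt_or_gt_of_ne (hne i j)).elim (fun hij => (huv i j hij).ne) fun hij => (hvu i j hij).ne'
  have hinj : Function.Injective (Sum.elim u v) :=
    Function.Injective.sumElim (StrictMono.injective hu) (StrictMono.injective hv) huvne
  have hsurj : Function.Surjective (Sum.elim u v) :=
    ((Fintype.bijective_iff_injective_and_card _).2 ⟨hinj, by simp⟩).2
  refine ⟨⟨(u, v), hu, hv, fun x => ?_⟩, fun i j => ⟨fun hij => ?_, huv i j⟩⟩
  · obtain ⟨i | j, hx⟩ := hsurj x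
    exacts [Or.inl ⟨i, hx⟩, Or.inr ⟨j, hx⟩]
  · by_contra hcon
    exact absurd hij (hvu i j (lt_of_le_of_ne (not_lt.1 hcon) (hne i j).symm)).not_gt

instance : Nonempty (ShuffleT a b) :=
  ⟨(exists_lt_iff (g := fun _ => 0) (h := fun _ => 1) monotone_const monotone_const
    fun _ _ => zero_ne_one).choose⟩

end ShuffleT

/-- The position, counted downwards from the top of a merged path with `m` internal vertices, of
the `i`-th vertex below the top of a path whose `a` internal vertices occupy, counted upwards
from the base, the places `f`. -/
def pathPos {a m : ℕ} (f : Fin a → Fin m) (i : ℕ) : ℕ :=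
  if h0 : i = 0 then 0 else if h : i ≤ a then m - f ⟨a - i, by omega⟩ else m + 1

section PathPos

variable {a m : ℕ} {f : Fin a → Fin m}

@[simp] theorem pathPos_zero : pathPos f 0 = 0 := rfl

theorem pathPos_of_pos {i : ℕ} (hi : 0 < i) (hia : i ≤ a) :
    pathPos f i = m - f ⟨a - i, by omega⟩ := by
  rw [pathPos, dif_neg hi.ne', dif_pos hia]

theorem pathPos_succ_self : pathPos f (a + 1) = m + 1 := by
  rw [pathPos, dif_neg (by omega), dif_neg (by omega)]

theorem pathPos_sub (i : Fin a) : pathPos f (a - i) = m - f i := by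
  rw [pathPos_of_pos (by omega) (by omega)]
  congr 3
  exact Fin.ext (by simp only; omega)

theorem pathPos_lt_succ (hf : ∀ i j, i < j → f i < f j) {i : ℕ} (hi : i ≤ a) :
    pathPos f i < pathPos f (i + 1) := by
  rcases Nat.eq_zero_or_pos i with rfl | hpos
  · rcases Nat.eq_zero_or_pos a with rfl | ha
    · rw [pathPos_succ_self]
      simp
    · rw [pathPos_of_pos (i := 0 + 1) (by omega) (by omega), pathPos_zero]
      exact Nat.sub_pos_of_lt (Fin.is_lt _)
  · rcases Nat.eq_or_lt_of_le hi with rfl | hlt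
    · rw [pathPos_succ_self, pathPos_of_pos hpos le_rfl]
      omega
    · rw [pathPos_of_pos hpos hi, pathPos_of_pos (i := i + 1) (by omega) hlt]
      have h1 : f ⟨a - (i + 1), by omega⟩ < f ⟨a - i, by omega⟩ :=
        hf _ _ (Fin.mk_lt_mk.2 (by omega))
      have h2 := (f ⟨a - i, by omega⟩).2
      rw [Fin.lt_def] at h1
      omega

theorem pathPos_strictMonoOn (hf : ∀ i j, i < j → f i < f j) {i j : ℕ} (hij : i < j)
    (hj : j ≤ a + 1) : pathPos f i < pathPos f j := by
  induction j, hij using Nat.le_induction with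
  | base => exact pathPos_lt_succ hf (by omega)
  | succ j hij ih => exact (ih (by omega)).trans (pathPos_lt_succ hf (by omega))

theorem lt_of_pathPos_lt (hf : ∀ i j, i < j → f i < f j) {i j : ℕ}
    (h : pathPos f i < pathPos f j) (hi : i ≤ a + 1) : i < j := by
  by_contra hij
  rcases Nat.eq_or_lt_of_le (not_lt.1 hij) with rfl | hlt
  · exact lt_irrefl _ h
  · exact lt_asymm h (pathPos_strictMonoOn hf hlt hi)

theorem exists_pathPos_eq {b : ℕ} (sh : ShuffleT a b) {z : ℕ} (hz : z ≤ a + b) :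
    (∃ i ≤ a, pathPos sh.1.1 i = z) ∨ ∃ j ≤ b, pathPos sh.1.2 j = z := by
  rcases Nat.eq_zero_or_pos z with rfl | hpos
  · exact Or.inl ⟨0, Nat.zero_le _, pathPos_zero⟩
  · rcases sh.2.2.2 ⟨a + b - z, by omega⟩ with ⟨i, hi⟩ | ⟨j, hj⟩
    · refine Or.inl ⟨a - i, Nat.sub_le _ _, ?_⟩
      rw [pathPos_sub, hi]
      simp only
      omega
    · refine Or.inr ⟨b - j, Nat.sub_le _ _, ?_⟩
      rw [pathPos_sub, hj]
      simp only
      omega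

end PathPos

namespace ExoticTree

/-- `φ` identifies the β-pair `b`, `mate b` of `t` and interleaves the two closing paths below it,
of `a` and `c` internal vertices, according to `sh`. -/
structure IsPathMerge (t t' : ExoticTree) (b : Fin (t.n + 1)) {a c : ℕ} (sh : ShuffleT a c)
    (φ : Fin (t.n + 1) → Fin (t'.n + 1)) : Prop where
  beta : t.colour b = some XColour.beta
  join : t.parent^[a + 1] b = t.parent^[c + 1] (t.mate b)
  ne_of_lt : ∀ i < a + 1, ∀ j < c + 1, t.parent^[i] b ≠ t.parent^[j] (t.mate b)
  surj : Function.Surjective φ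
  map_zero : φ 0 = 0
  map_mate_base : φ b = φ (t.mate b)
  eq_or : ∀ u v, φ u = φ v → u = v ∨ ((u = b ∨ u = t.mate b) ∧ (v = b ∨ v = t.mate b))
  colour_map : ∀ v, v ≠ b → v ≠ t.mate b → t'.colour (φ v) = t.colour v
  mate_map : ∀ v, v ≠ b → v ≠ t.mate b → t'.mate (φ v) = φ (t.mate v)
  mate_map_base : t'.mate (φ b) = φ b
  parent_map : ∀ v, (∀ i ≤ a, v ≠ t.parent^[i] b) → (∀ j ≤ c, v ≠ t.parent^[j] (t.mate b)) →
    t'.parent (φ v) = φ (t.parent v)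
  map_fst : ∀ i ≤ a + 1, φ (t.parent^[i] b) = t'.parent^[pathPos sh.1.1 i] (φ b)
  map_snd : ∀ j ≤ c + 1, φ (t.parent^[j] (t.mate b)) = t'.parent^[pathPos sh.1.2 j] (φ b)

theorem IsMergeAt.exists_isPathMerge {t t' : ExoticTree} {b : Fin (t.n + 1)} {a c : ℕ}
    {sh : ShuffleT a c} (hβ : t.colour b = some XColour.beta)
    (hfc : t.FirstCommon b (a + 1) (c + 1)) (h : t.IsMergeAt b (a + 1) (c + 1) sh t') :
    ∃ φ, IsPathMerge t t' b sh φ := by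
  obtain ⟨-, φ, hsurj, h0, hb, heq, hcol, -, hmate, hmateb, hpar, ch, hlast, hzero, hsucc, hfst,
    hsnd⟩ := h
  obtain ⟨-, -, hjoin, hne⟩ := hfc
  change Fin (a + c + 1) → Fin (t'.n + 1) at ch
  change ch (Fin.last (a + c)) = φ b at hlast
  change ∀ i : Fin (a + c), t'.parent (ch i.succ) = ch i.castSucc at hsucc
  change ∀ i : Fin a, ch ((sh.1.1 i).castSucc) = φ (t.parent^[a - (i : ℕ)] b) at hfst
  change ∀ j : Fin c, ch ((sh.1.2 j).castSucc) = φ (t.parent^[c - (j : ℕ)] (t.mate b)) at hsnd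
  have hch : ∀ x : Fin (a + c + 1), ch x = t'.parent^[a + c - x] (φ b) := by
    intro x
    induction x using Fin.reverseInduction with
    | last => simp [hlast]
    | cast x ih =>
      have hx : a + c - (x.castSucc : ℕ) = (a + c - (x.succ : ℕ)) + 1 := by
        simp only [Fin.val_castSucc, Fin.val_succ]
        omega
      rw [← hsucc, ih, hx, Function.iterate_succ_apply']
  have hbase : φ (t.parent^[a + 1] b) = t'.parent^[a + c + 1] (φ b) := by
    rw [← hzero, hch, Function.iterate_succ_apply']
    simp
  refine ⟨φ, hβ, hjoin, hne, hsurj, h0, hb, heq, hcol, hmate, hmateb, fun v hv1 hv2 => ?_,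
    fun i hi => ?_, fun j hj => ?_⟩
  · refine hpar v (hv1 0 (Nat.zero_le _)) (hv2 0 (Nat.zero_le _)) ?_
    rintro (⟨i, -, hi, hv⟩ | ⟨j, -, hj, hv⟩)
    exacts [hv1 i (by omega) hv, hv2 j (by omega) hv]
  · rcases Nat.eq_zero_or_pos i with rfl | hpos
    · simp
    rcases Nat.eq_or_lt_of_le hi with rfl | hlt
    · rw [pathPos_succ_self, hbase]
    · have := hfst ⟨a - i, by omega⟩
      rw [hch] at this
      rw [pathPos_of_pos hpos (by omega)]
      simp only [Fin.val_castSucc] at this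
      rw [this]
      congr 2
      omega
  · rcases Nat.eq_zero_or_pos j with rfl | hpos
    · simp [hb]
    rcases Nat.eq_or_lt_of_le hj with rfl | hlt
    · rw [pathPos_succ_self, ← hjoin, hbase]
    · have := hsnd ⟨c - j, by omega⟩
      rw [hch] at this
      rw [pathPos_of_pos hpos (by omega)]
      simp only [Fin.val_castSucc] at this
      rw [this]
      congr 2
      omega

namespace IsPathMerge

variable {t t' : ExoticTree} {b : Fin (t.n + 1)} {a c : ℕ} {sh : ShuffleT a c}
  {φ : Fin (t.n + 1) → Fin (t'.n + 1)}

theorem base_ne_zero (h : IsPathMerge t t' b sh φ) : b ≠ 0 := ne_zero_of_colour h.beta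

theorem eq_zero_of_map_eq_zero (h : IsPathMerge t t' b sh φ) {v : Fin (t.n + 1)}
    (hv : φ v = 0) : v = 0 := by
  rcases h.eq_or v 0 (hv.trans h.map_zero.symm) with h0 | ⟨-, h0 | h0⟩
  exacts [h0, absurd h0.symm h.base_ne_zero, absurd h0.symm (mate_ne_zero h.base_ne_zero)]

theorem exists_iterate_of_lt (h : IsPathMerge t t' b sh φ) {i j : ℕ} (hij : i < j) :
    (j ≤ a + 1 → ∃ k, 0 < k ∧ φ (t.parent^[j] b) = t'.parent^[k] (φ (t.parent^[i] b))) ∧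
    (j ≤ c + 1 → ∃ k, 0 < k ∧
      φ (t.parent^[j] (t.mate b)) = t'.parent^[k] (φ (t.parent^[i] (t.mate b)))) := by
  constructor <;> intro hj
  · have hlt := pathPos_strictMonoOn sh.2.1 hij hj
    refine ⟨_, Nat.sub_pos_of_lt hlt, ?_⟩
    rw [h.map_fst j hj, h.map_fst i (by omega), ← Function.iterate_add_apply,
      Nat.sub_add_cancel hlt.le]
  · have hlt := pathPos_strictMonoOn sh.2.2.1 hij hj
    refine ⟨_, Nat.sub_pos_of_lt hlt, ?_⟩
    rw [h.map_snd j hj, h.map_snd i (by omega), ← Function.iterate_add_apply,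
      Nat.sub_add_cancel hlt.le]

theorem exists_map_parent (h : IsPathMerge t t' b sh φ) (v : Fin (t.n + 1)) :
    ∃ k, 0 < k ∧ φ (t.parent v) = t'.parent^[k] (φ v) := by
  by_cases h1 : ∀ i ≤ a, v ≠ t.parent^[i] b
  · by_cases h2 : ∀ j ≤ c, v ≠ t.parent^[j] (t.mate b)
    · exact ⟨1, one_pos, (h.parent_map v h1 h2).symm⟩
    · push Not at h2
      obtain ⟨j, hj, rfl⟩ := h2
      rw [← Function.iterate_succ_apply' t.parent]
      exact (h.exists_iterate_of_lt (Nat.lt_succ_self j)).2 (by omega)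
  · push Not at h1
    obtain ⟨i, hi, rfl⟩ := h1
    rw [← Function.iterate_succ_apply' t.parent]
    exact (h.exists_iterate_of_lt (Nat.lt_succ_self i)).1 (by omega)

theorem exists_map_iterate (h : IsPathMerge t t' b sh φ) (k : ℕ) (v : Fin (t.n + 1)) :
    ∃ k', φ (t.parent^[k] v) = t'.parent^[k'] (φ v) := by
  induction k with
  | zero => exact ⟨0, rfl⟩
  | succ k ih =>
    obtain ⟨k', hk'⟩ := ih
    obtain ⟨l, -, hl⟩ := h.exists_map_parent (t.parent^[k] v)
    exact ⟨l + k', by rw [Function.iterate_succ_apply', hl, hk', Function.iterate_add_apply]⟩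

theorem map_eq_or_iff (h : IsPathMerge t t' b sh φ) (u v : Fin (t.n + 1)) :
    (φ u = φ v ∨ φ u = t'.mate (φ v)) ↔ (u = v ∨ u = t.mate v) := by
  have hmm := t.mate_mate
  by_cases hv : v = b ∨ v = t.mate b
  · have hφv : φ v = φ b := by
      rcases hv with rfl | rfl
      exacts [rfl, h.map_mate_base.symm]
    have hm : t'.mate (φ v) = φ v := by rw [hφv, h.mate_map_base]
    rw [hm, or_self]
    constructor
    · intro huv
      rcases h.eq_or u v huv with huv | ⟨hu | hu, hv | hv⟩
      exacts [Or.inl huv, Or.inl (hu.trans hv.symm), Or.inr (by rw [hv, hmm, hu]),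
        Or.inr (by rw [hv, hu]), Or.inl (hu.trans hv.symm)]
    · rintro (rfl | rfl)
      · rfl
      · rw [hφv]
        rcases hv with rfl | rfl
        exacts [h.map_mate_base.symm, by rw [hmm]]
  · push Not at hv
    rw [h.mate_map v hv.1 hv.2]
    constructor
    · rintro (huv | huv)
      · rcases h.eq_or _ _ huv with huv | ⟨-, huv | huv⟩
        exacts [Or.inl huv, absurd huv hv.1, absurd huv hv.2]
      · rcases h.eq_or _ _ huv with huv | ⟨-, huv | huv⟩
        exacts [Or.inr huv, absurd (by rw [← huv, hmm]) hv.2,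
          absurd (t.mate_involutive.injective huv) hv.1]
    · rintro (rfl | rfl) <;> simp

theorem iterate_mate_ne (h : IsPathMerge t t' b sh φ)
    (hgood : ∀ x, t'.colour x = some XColour.beta → ∀ k, t'.parent^[k] x ≠ t'.mate x)
    {x : Fin (t.n + 1)} (hx : t.colour x = some XColour.beta) (k : ℕ) :
    t.parent^[k] x ≠ t.mate x := by
  intro hk
  have hcycle : ∀ {y : Fin (t.n + 1)}, y ≠ 0 → ∀ {l}, 0 < l → t.parent^[l] y ≠ y :=
    fun hy l hl hy' => hy (t.isRooted.eq_root_of_periodic hl hy')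
  by_cases hxb : x = b
  · subst hxb
    rcases lt_or_ge k (a + 1) with hlt | hge
    · exact h.ne_of_lt k hlt 0 (by omega) hk
    · refine hcycle (mate_ne_zero h.base_ne_zero) (l := k - (a + 1) + (c + 1)) (by omega) ?_
      rw [Function.iterate_add_apply, ← h.join, ← Function.iterate_add_apply,
        Nat.sub_add_cancel hge, hk]
  by_cases hxm : x = t.mate b
  · subst hxm
    rw [t.mate_mate] at hk
    rcases lt_or_ge k (c + 1) with hlt | hge
    · exact h.ne_of_lt 0 (by omega) k hlt hk.symm
    · refine hcycle h.base_ne_zero (l := k - (c + 1) + (a + 1)) (by omega) ?_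
      rw [Function.iterate_add_apply, h.join, ← Function.iterate_add_apply,
        Nat.sub_add_cancel hge, hk]
  obtain ⟨k', hk'⟩ := h.exists_map_iterate k x
  refine hgood (φ x) ((h.colour_map x hxb hxm).trans hx) k' ?_
  rw [← hk', hk, h.mate_map x hxb hxm]

theorem iterate_ne_mate_iterate (h : IsPathMerge t t' b sh φ)
    (hgood : ∀ x, t'.colour x = some XColour.beta → ∀ k, t'.parent^[k] x ≠ t'.mate x)
    {i j : ℕ} (hi : 0 < i) (hia : i ≤ a) (hjc : j ≤ c) :
    t.parent^[i] b ≠ t.mate (t.parent^[j] (t.mate b)) := by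
  intro hij
  set x := t.parent^[i] b with hx
  have hmx : t.mate x = t.parent^[j] (t.mate b) := by rw [hij, t.mate_mate]
  have hβ : t.colour x = some XColour.beta := by
    by_contra hcon
    rw [t.mate_nonbeta x hcon] at hmx
    exact h.ne_of_lt i (by omega) j (by omega) hmx
  have hxb : x ≠ b := fun hxb =>
    h.base_ne_zero (t.isRooted.eq_root_of_periodic hi (hx.symm.trans hxb))
  have hxm : x ≠ t.mate b := fun hxm => h.ne_of_lt i (by omega) 0 (by omega) hxm
  have hβ' : t'.colour (φ x) = some XColour.beta := (h.colour_map x hxb hxm).trans hβ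
  have h1 := h.map_fst i (by omega)
  have h2 := h.map_snd j (by omega)
  rw [← hmx, ← h.mate_map x hxb hxm] at h2
  rw [← hx] at h1
  rcases le_total (pathPos sh.1.1 i) (pathPos sh.1.2 j) with hle | hle
  · refine hgood (φ x) hβ' (pathPos sh.1.2 j - pathPos sh.1.1 i) ?_
    rw [h2, h1, ← Function.iterate_add_apply, Nat.sub_add_cancel hle]
  · refine hgood (t'.mate (φ x)) ((t'.colour_mate _).trans hβ')
      (pathPos sh.1.1 i - pathPos sh.1.2 j) ?_
    rw [t'.mate_mate, h2, ← Function.iterate_add_apply, Nat.sub_add_cancel hle, h1]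

end IsPathMerge

end ExoticTree

namespace ExoticTree

/-- The relative order of the labels of `f` on the two closing paths is the shuffle `sh`. -/
def IsShuffledBy (t : ExoticTree) (b : Fin (t.n + 1)) {a c : ℕ} (sh : ShuffleT a c)
    (f : Fin (t.n + 1) → ℕ) : Prop :=
  ∀ i j, sh.1.1 i < sh.1.2 j ↔ f (t.parent^[a - i] b) < f (t.parent^[c - j] (t.mate b))

namespace IsPathMerge

variable {t t' : ExoticTree} {b : Fin (t.n + 1)} {a c : ℕ} {sh : ShuffleT a c}
  {φ : Fin (t.n + 1) → Fin (t'.n + 1)}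

theorem comp_mem_labellings (h : IsPathMerge t t' b sh φ) {f' : Fin (t'.n + 1) → ℕ}
    (hf' : f' ∈ labellings 0 t'.parent t'.mate) : f' ∘ φ ∈ labellings 0 t.parent t.mate := by
  refine ⟨fun u v => (hf'.1 _ _).trans (h.map_eq_or_iff u v), fun v hv => ?_, fun v k hk => ?_⟩
  · obtain ⟨k, hk, hφ⟩ := h.exists_map_parent v
    simp only [Function.comp_apply, hφ]
    exact apply_iterate_lt_of_mem_labellings t'.isRooted hf' hk
      fun h0 => hv (h.eq_zero_of_map_eq_zero h0)
  · obtain ⟨w, hw⟩ := hf'.2.2 (φ v) k hk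
    obtain ⟨u, rfl⟩ := h.surj w
    exact ⟨u, hw⟩

theorem isShuffledBy_comp (h : IsPathMerge t t' b sh φ) {f' : Fin (t'.n + 1) → ℕ}
    (hf' : f' ∈ labellings 0 t'.parent t'.mate) : t.IsShuffledBy b sh (f' ∘ φ) := by
  intro i j
  have h1 := h.map_fst (a - i) (by omega)
  have h2 := h.map_snd (c - j) (by omega)
  rw [pathPos_sub] at h1 h2
  have hi := (sh.1.1 i).2
  have hj := (sh.1.2 j).2
  simp only [Function.comp_apply]
  constructor
  · intro hij
    have hA : φ (t.parent^[a - i] b) = t'.parent^[(sh.1.2 j : ℕ) - sh.1.1 i]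
        (φ (t.parent^[c - j] (t.mate b))) := by
      rw [h1, h2, ← Function.iterate_add_apply]
      congr 2
      rw [Fin.lt_def] at hij
      omega
    rw [hA]
    refine apply_iterate_lt_of_mem_labellings t'.isRooted hf' (Nat.sub_pos_of_lt hij) fun h0 => ?_
    rw [h0, t'.isRooted.iterate_root] at hA
    exact h.ne_of_lt _ (by omega) _ (by omega)
      ((h.eq_zero_of_map_eq_zero hA).trans (h.eq_zero_of_map_eq_zero h0).symm)
  · intro hlt
    by_contra hij
    have hB : φ (t.parent^[c - j] (t.mate b)) = t'.parent^[(sh.1.1 i : ℕ) - sh.1.2 j]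
        (φ (t.parent^[a - i] b)) := by
      rw [h1, h2, ← Function.iterate_add_apply]
      congr 2
      rw [Fin.lt_def] at hij
      omega
    rw [hB] at hlt
    exact hlt.not_ge (apply_iterate_le_of_mem_labellings t'.isRooted hf' _ _)

theorem exists_comp_eq (h : IsPathMerge t t' b sh φ)
    (hgood : ∀ x, t'.colour x = some XColour.beta → ∀ k, t'.parent^[k] x ≠ t'.mate x)
    {f : Fin (t.n + 1) → ℕ} (hf : f ∈ labellings 0 t.parent t.mate)
    (hsh : t.IsShuffledBy b sh f) :
    ∃ f' ∈ labellings 0 t'.parent t'.mate, f' ∘ φ = f := by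
  obtain ⟨f', hf'⟩ : ∃ f' : Fin (t'.n + 1) → ℕ, ∀ v, f' (φ v) = f v :=
    ⟨f ∘ Function.surjInv h.surj, fun v => (hf.1 _ _).2
      ((h.map_eq_or_iff _ _).1 (Or.inl (Function.surjInv_eq h.surj _)))⟩
  have hiter : ∀ {x : Fin (t.n + 1)} {i j : ℕ}, i < j → t.parent^[i] x ≠ 0 →
      f (t.parent^[j] x) < f (t.parent^[i] x) := fun {x i j} hij hx => by
    rw [← Nat.sub_add_cancel hij.le, Function.iterate_add_apply]
    exact apply_iterate_lt_of_mem_labellings t.isRooted hf (Nat.sub_pos_of_lt hij) hx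
  have hne0 : ∀ {v}, φ v ≠ 0 → v ≠ 0 := fun hv h0 => hv (by rw [h0, h.map_zero])
  have hchain : ∀ z ≤ a + c, t'.parent^[z] (φ b) ≠ 0 →
      f' (t'.parent^[z + 1] (φ b)) < f' (t'.parent^[z] (φ b)) := by
    intro z hz hz0
    have fst_fst : ∀ i i', i ≤ a → i' ≤ a + 1 → pathPos sh.1.1 i = z →
        pathPos sh.1.1 i' = z + 1 →
        f' (t'.parent^[z + 1] (φ b)) < f' (t'.parent^[z] (φ b)) := by
      intro i i' hi hi' hiz hiz'
      have hlt := lt_of_pathPos_lt sh.2.1 (hiz.trans_lt ((Nat.lt_succ_self z).trans_eq hiz'.symm))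
        (show i ≤ a + 1 by omega)
      rw [← hiz, ← h.map_fst i (by omega)] at hz0 ⊢
      rw [hiz, ← hiz', ← h.map_fst i' hi', hf', hf']
      exact hiter hlt (hne0 hz0)
    have snd_snd : ∀ j j', j ≤ c → j' ≤ c + 1 → pathPos sh.1.2 j = z →
        pathPos sh.1.2 j' = z + 1 →
        f' (t'.parent^[z + 1] (φ b)) < f' (t'.parent^[z] (φ b)) := by
      intro j j' hj hj' hjz hjz'
      have hlt := lt_of_pathPos_lt sh.2.2.1 (hjz.trans_lt ((Nat.lt_succ_self z).trans_eq hjz'.symm))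
        (show j ≤ c + 1 by omega)
      rw [← hjz, ← h.map_snd j (by omega)] at hz0 ⊢
      rw [hjz, ← hjz', ← h.map_snd j' hj', hf', hf']
      exact hiter hlt (hne0 hz0)
    rcases exists_pathPos_eq sh hz with ⟨i, hi, hiz⟩ | ⟨j, hj, hjz⟩
    · rcases Nat.eq_or_lt_of_le hz with rfl | hlt
      · exact fst_fst i (a + 1) hi le_rfl hiz pathPos_succ_self
      rcases exists_pathPos_eq sh (show z + 1 ≤ a + c from hlt) with
        ⟨i', hi', hiz'⟩ | ⟨j', hj', hjz'⟩
      · exact fst_fst i i' hi (by omega) hiz hiz'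
      rcases Nat.eq_zero_or_pos i with rfl | hpos
      · exact snd_snd 0 j' (Nat.zero_le _) (by omega) hiz hjz'
      have hpos' : 0 < j' := Nat.pos_of_ne_zero fun h0 => by
        rw [h0, pathPos_zero] at hjz'
        omega
      have key := hsh ⟨a - i, by omega⟩ ⟨c - j', by omega⟩
      simp only [Nat.sub_sub_self hi, Nat.sub_sub_self hj'] at key
      have hne : f (t.parent^[i] b) ≠ f (t.parent^[j'] (t.mate b)) := fun heq =>
        ((hf.1 _ _).1 heq).elim (h.ne_of_lt i (by omega) j' (by omega))
          (h.iterate_ne_mate_iterate hgood hpos hi hj')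
      have hnlt : ¬ sh.1.1 ⟨a - i, by omega⟩ < sh.1.2 ⟨c - j', by omega⟩ := by
        rw [pathPos_of_pos hpos hi] at hiz
        rw [pathPos_of_pos hpos' hj'] at hjz'
        rw [Fin.lt_def]
        omega
      rw [← hjz', ← h.map_snd j' (by omega), ← hiz, ← h.map_fst i (by omega), hf', hf']
      exact lt_of_le_of_ne (not_lt.1 (mt key.2 hnlt)) hne.symm
    · rcases Nat.eq_or_lt_of_le hz with rfl | hlt
      · exact snd_snd j (c + 1) hj le_rfl hjz pathPos_succ_self
      rcases exists_pathPos_eq sh (show z + 1 ≤ a + c from hlt) with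
        ⟨i', hi', hiz'⟩ | ⟨j', hj', hjz'⟩
      swap
      · exact snd_snd j j' hj (by omega) hjz hjz'
      rcases Nat.eq_zero_or_pos j with rfl | hpos
      · exact fst_fst 0 i' (Nat.zero_le _) (by omega) hjz hiz'
      have hpos' : 0 < i' := Nat.pos_of_ne_zero fun h0 => by
        rw [h0, pathPos_zero] at hiz'
        omega
      have key := hsh ⟨a - i', by omega⟩ ⟨c - j, by omega⟩
      simp only [Nat.sub_sub_self hi', Nat.sub_sub_self hj] at key
      rw [← hiz', ← h.map_fst i' (by omega), ← hjz, ← h.map_snd j (by omega), hf', hf',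
        ← key, Fin.lt_def]
      rw [pathPos_of_pos hpos hj] at hjz
      rw [pathPos_of_pos hpos' hi'] at hiz'
      omega
  refine ⟨f', ⟨fun x y => ?_, fun x hx => ?_, fun x k hk => ?_⟩, funext hf'⟩
  · obtain ⟨u, rfl⟩ := h.surj x
    obtain ⟨v, rfl⟩ := h.surj y
    rw [hf', hf', h.map_eq_or_iff]
    exact hf.1 u v
  · obtain ⟨v, rfl⟩ := h.surj x
    by_cases h1 : ∀ i ≤ a, v ≠ t.parent^[i] b
    · by_cases h2 : ∀ j ≤ c, v ≠ t.parent^[j] (t.mate b)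
      · rw [h.parent_map v h1 h2, hf', hf']
        exact hf.2.1 v (hne0 hx)
      · push Not at h2
        obtain ⟨j, hj, rfl⟩ := h2
        rw [h.map_snd j (by omega)] at hx ⊢
        rw [← Function.iterate_succ_apply' t'.parent]
        refine hchain _ (Nat.le_of_lt_succ ?_) hx
        exact (pathPos_strictMonoOn sh.2.2.1 (Nat.lt_succ_of_le hj) le_rfl).trans_eq
          pathPos_succ_self
    · push Not at h1
      obtain ⟨i, hi, rfl⟩ := h1
      rw [h.map_fst i (by omega)] at hx ⊢
      rw [← Function.iterate_succ_apply' t'.parent]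
      refine hchain _ (Nat.le_of_lt_succ ?_) hx
      exact (pathPos_strictMonoOn sh.2.1 (Nat.lt_succ_of_le hi) le_rfl).trans_eq pathPos_succ_self
  · obtain ⟨v, rfl⟩ := h.surj x
    rw [hf'] at hk
    obtain ⟨u, hu⟩ := hf.2.2 v k hk
    exact ⟨φ u, (hf' u).trans hu⟩

theorem ncard_isShuffledBy (h : IsPathMerge t t' b sh φ)
    (hgood : ∀ x, t'.colour x = some XColour.beta → ∀ k, t'.parent^[k] x ≠ t'.mate x) :
    {f ∈ labellings 0 t.parent t.mate | t.IsShuffledBy b sh f}.ncard = t'.numLabellings := by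
  refine Eq.symm (Set.ncard_congr (fun f' _ => f' ∘ φ)
    (fun f' hf' => ?_) (fun _ _ _ _ heq => h.surj.injective_comp_right heq) fun f hf => ?_)
  · exact ⟨h.comp_mem_labellings hf', h.isShuffledBy_comp hf'⟩
  · obtain ⟨f', hf', heq⟩ := h.exists_comp_eq hgood hf.1 hf.2
    exact ⟨f', hf', heq⟩

end IsPathMerge

theorem numLabellings_eq_sum {t : ExoticTree} {b : Fin (t.n + 1)} {a c : ℕ}
    {next : ShuffleT a c → ExoticTree} {φ : ∀ sh, Fin (t.n + 1) → Fin ((next sh).n + 1)}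
    (h : ∀ sh, IsPathMerge t (next sh) b sh (φ sh))
    (hgood : ∀ sh x, (next sh).colour x = some XColour.beta →
      ∀ k, (next sh).parent^[k] x ≠ (next sh).mate x) :
    t.numLabellings = ∑ sh, (next sh).numLabellings := by
  rw [numLabellings, ncard_eq_sum_of_existsUnique finite_labellings Finset.univ
    (fun sh f => t.IsShuffledBy b sh f)]
  · exact Finset.sum_congr rfl fun sh _ => (h sh).ncard_isShuffledBy (hgood sh)
  · intro f hf
    have hmono : ∀ x (l : ℕ), Monotone fun i : Fin l => f (t.parent^[l - i] x) := by
      intro x l i j hij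
      have hle : l - (j : ℕ) ≤ l - i := Nat.sub_le_sub_left hij l
      simp only
      rw [← Nat.sub_add_cancel hle, Function.iterate_add_apply]
      exact apply_iterate_le_of_mem_labellings t.isRooted hf _ _
    obtain ⟨sh₀⟩ := (inferInstance : Nonempty (ShuffleT a c))
    obtain ⟨sh, hsh⟩ := ShuffleT.exists_lt_iff (hmono b a) (hmono (t.mate b) c)
      fun i j heq => ((hf.1 _ _).1 heq).elim
        ((h sh₀).ne_of_lt _ (by omega) _ (by omega))
        ((h sh₀).iterate_ne_mate_iterate (hgood sh₀) (by omega) (by omega) (by omega))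
    exact ⟨sh, ⟨Finset.mem_univ _, hsh⟩, fun sh' hsh' =>
      ShuffleT.ext_of_lt_iff fun i j => (hsh'.2 i j).trans (hsh i j).symm⟩

theorem colour_ne_of_numBeta {t : ExoticTree} (h0 : t.numBeta = 0) (v : Fin (t.n + 1)) :
    t.colour v ≠ some XColour.beta := fun hv =>
  Finset.notMem_empty v (Finset.card_eq_zero.1 h0 ▸ Finset.mem_filter.2 ⟨Finset.mem_univ v, hv⟩)

theorem exists_isPathMerge {t : ExoticTree} {b : Fin (t.n + 1)} {a c : ℕ}
    {next : ShuffleT a c → ExoticTree} (hβ : t.colour b = some XColour.beta)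
    (hfc : t.FirstCommon b (a + 1) (c + 1))
    (hmerge : ∀ sh, t.IsMergeAt b (a + 1) (c + 1) sh (next sh)) :
    ∃ φ : ∀ sh, Fin (t.n + 1) → Fin ((next sh).n + 1),
      ∀ sh, IsPathMerge t (next sh) b sh (φ sh) :=
  ⟨fun sh => ((hmerge sh).exists_isPathMerge hβ hfc).choose,
    fun sh => ((hmerge sh).exists_isPathMerge hβ hfc).choose_spec⟩

end ExoticTree

theorem IsReduction.iterate_ne_mate {t : ExoticTree} {M : Multiset PTree} (h : IsReduction t M)
    (x : Fin (t.n + 1)) (hx : t.colour x = some XColour.beta) (k : ℕ) :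
    t.parent^[k] x ≠ t.mate x := by
  induction h generalizing k with
  | base t s h0 => exact absurd hx (colour_ne_of_numBeta h0 x)
  | merge t b d₁ d₂ hβ hnear next Ms hmerge hnext ih =>
    obtain ⟨a, rfl⟩ := Nat.exists_eq_succ_of_ne_zero hnear.1.1.ne'
    obtain ⟨c, rfl⟩ := Nat.exists_eq_succ_of_ne_zero hnear.1.2.1.ne'
    obtain ⟨φ, hφ⟩ := exists_isPathMerge hβ hnear.1 hmerge
    obtain ⟨sh⟩ := (inferInstance : Nonempty (ShuffleT a c))
    exact (hφ sh).iterate_mate_ne (fun x hx k => ih sh x hx k) hx k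

theorem IsReduction.numLabellings_eq {pfac : PTree → ℕ} (hpfac : IsPlainFactorial pfac)
    {t : ExoticTree} {M : Multiset PTree} (h : IsReduction t M) :
    (t.numLabellings : ℚ) =
      (M.map fun s => (Nat.factorial (s.n + 1) : ℚ) / (pfac s : ℚ)).sum := by
  induction h with
  | base t s h0 hiso =>
    obtain ⟨e, he0, he⟩ := hiso
    rw [Multiset.map_singleton, Multiset.sum_singleton, numLabellings,
      ncard_labellings_of_equiv (m' := id) e he0 he
        (fun v => by rw [t.mate_nonbeta v (colour_ne_of_numBeta h0 v), id]),
      ncard_labellings_id s.n s.isRooted (Fintype.card_fin _), PTree.factorial_eq_prod hpfac]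
    push_cast
    rfl
  | merge t b d₁ d₂ hβ hnear next Ms hmerge hnext ih =>
    obtain ⟨a, rfl⟩ := Nat.exists_eq_succ_of_ne_zero hnear.1.1.ne'
    obtain ⟨c, rfl⟩ := Nat.exists_eq_succ_of_ne_zero hnear.1.2.1.ne'
    obtain ⟨φ, hφ⟩ := exists_isPathMerge hβ hnear.1 hmerge
    rw [numLabellings_eq_sum hφ fun sh => (hnext sh).iterate_ne_mate, Nat.cast_sum,
      ← Multiset.coe_mapAddMonoidHom, map_sum, ← Multiset.coe_sumAddMonoidHom, map_sum]
    exact Finset.sum_congr rfl fun sh _ => ih sh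

/-- Let `τ` be an exotic coloured tree whose graph obtained by
identifying each β-pair to a single vertex is acyclic, with effective size `|τ|`,
exotic tree factorial `τ!` and reduction multiset `R(τ)`.  Then
`|τ|!/τ! = Σ_{τ̄ ∈ R(τ)} |τ̄|!/τ̄!`, where for an uncoloured rooted tree `τ̄`, `|τ̄|`
is its number of vertices and `τ̄!` is the standard tree factorial. -/
theorem stmt12 (efac : ExoticTree → ℚ) (hefac : IsTreeFactorial efac)
    (pfac : PTree → ℕ) (hpfac : IsPlainFactorial pfac)
    (t : ExoticTree) (hacyc : t.IdAcyclic)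
    (M : Multiset PTree) (hred : IsReduction t M) :
    (Nat.factorial t.effSize : ℚ) / efac t =
      (M.map fun s => (Nat.factorial (s.n + 1) : ℚ) / (pfac s : ℚ)).sum := by
  rw [factorial_effSize_div hefac, hred.numLabellings_eq hpfac]
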